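/- arXiv:quant-ph/0511029 — 5 statements merged into one kernel-verified Lean document; each statement's English description precedes it below -/
import Mathlib

section
/- Let m and n be positive integers. The set QMP(m,n) of admissible spectral triples is convex: if (a,b,c) and (a',b',c') belong to QMP(m,n) and p ∈ [0,1], then (p·a + (1-p)·a', p·b + (1-p)·b', p·c + (1-p)·c') belongs to QMP(m,n). -/
open Matrix
open scoped ComplexOrder

noncomputable section

/-- A density operator: positive semidefinite with trace 1. -/
def IsDensityOp {I : Type*} [Fintype I] (ρ : Matrix I I ℂ) : Prop :=
  ρ.PosSemidef ∧ ρ.trace = 1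

/-- Partial trace over the second tensor factor. -/
def ptraceB {I J : Type*} [Fintype J] (ρ : Matrix (I × J) (I × J) ℂ) :
    Matrix I I ℂ :=
  Matrix.of fun i i' => ∑ j, ρ (i, j) (i', j)

/-- Partial trace over the first tensor factor. -/
def ptraceA {I J : Type*} [Fintype I] (ρ : Matrix (I × J) (I × J) ℂ) :
    Matrix J J ℂ :=
  Matrix.of fun j j' => ∑ i, ρ (i, j) (i, j')

/-- `a` is the spectrum of `A`: the vector of eigenvalues of the Hermitian matrix `A`
listed in nonincreasing order (with respect to the ordering of the index type given by
the equivalence `e` with `Fin d`). -/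
def IsSpectrum {d : ℕ} {I : Type*} [Fintype I] [DecidableEq I]
    (A : Matrix I I ℂ) (e : I ≃ Fin d) (a : I → ℝ) : Prop :=
  ∃ hA : A.IsHermitian,
    (∃ σ : Equiv.Perm I, a = hA.eigenvalues ∘ σ) ∧ Antitone (a ∘ e.symm)

/-- The set of admissible spectral triples. -/
def QMP (m n : ℕ) :
    Set ((Fin m → ℝ) × (Fin n → ℝ) × (Fin m × Fin n → ℝ)) :=
  {t | ∃ ρ : Matrix (Fin m × Fin n) (Fin m × Fin n) ℂ,
    IsDensityOp ρ ∧
    IsSpectrum (ptraceB ρ) (Equiv.refl (Fin m)) t.1 ∧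
    IsSpectrum (ptraceA ρ) (Equiv.refl (Fin n)) t.2.1 ∧
    IsSpectrum ρ finProdFinEquiv t.2.2}

open MeasureTheory in
theorem norm_sq_le_finrank_mul_of_irreducible {K : Type*} [Group K] [TopologicalSpace K]
    [IsTopologicalGroup K] [CompactSpace K] {E : Type*} [NormedAddCommGroup E]
    [InnerProductSpace ℂ E] [FiniteDimensional ℂ E] (ρ : K →* (E →L[ℂ] E)) (hρ : Continuous ρ)
    (hiso : ∀ k v w, inner ℂ (ρ k v) (ρ k w) = inner ℂ v w) (U : Submodule ℂ E)
    (hU : ∀ k, ∀ u ∈ U, ρ k u ∈ U)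
    (hirr : ∀ U' : Submodule ℂ E, U' ≤ U → (∀ k, ∀ u ∈ U', ρ k u ∈ U') → U' = ⊥ ∨ U' = U)
    (h : E) (hhU : h ∈ U) (hh : ‖h‖ = 1) (u : E) (hu : u ∈ U) (M : ℝ)
    (hM : ∀ k, ‖inner ℂ (ρ k h) u‖ ^ 2 ≤ M) :
    ‖u‖ ^ 2 ≤ Module.finrank ℂ U * M := by
  have hcs : CompleteSpace E := FiniteDimensional.complete ℂ E
  let _ : MeasurableSpace K := borel K
  have : BorelSpace K := ⟨rfl⟩
  let μ : Measure K := Measure.haarMeasure ⊤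
  have hμ : μ Set.univ = 1 := by
    have := Measure.haarMeasure_self (G := K) (K₀ := ⊤)
    simpa using this
  have : IsProbabilityMeasure μ := ⟨hμ⟩
  have hadj : ∀ k v w, inner ℂ (ρ k v) w = inner ℂ v (ρ k⁻¹ w) := by
    intro k v w
    rw [← hiso k v (ρ k⁻¹ w), ← mul_apply_eq_comp, ← map_mul]
    simp
  have hcont : ∀ v, Continuous fun k => ρ k v := fun v => hρ.clm_apply continuous_const
  have hint : ∀ {F : Type _} [NormedAddCommGroup F] (f : K → F), Continuous f → Integrable f μ :=
    fun f hf => hf.integrable_of_hasCompactSupport (HasCompactSupport.of_compactSpace f)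
  let T : E →ₗ[ℂ] E :=
    { toFun := fun v => ∫ k, inner ℂ (ρ k h) v • ρ k h ∂μ
      map_add' := by
        intro v w
        rw [← integral_add]
        · congr 1; ext k; rw [inner_add_right, add_smul]
        · exact hint _ (((hcont h).inner continuous_const).smul (hcont h))
        · exact hint _ (((hcont h).inner continuous_const).smul (hcont h))
      map_smul' := by
        intro c v
        rw [← integral_smul]
        congr 1; ext k; rw [inner_smul_right, mul_smul]; rfl }
  have hTdef : ∀ v, T v = ∫ k, inner ℂ (ρ k h) v • ρ k h ∂μ := fun v => rfl
  have hintT : ∀ v, Integrable (fun k => inner ℂ (ρ k h) v • ρ k h) μ := fun v =>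
    hint _ (((hcont h).inner continuous_const).smul (hcont h))
  have hintR : ∀ v, Integrable (fun k => ‖inner ℂ (ρ k h) v‖ ^ 2) μ := by
    intro v
    have hc : Continuous fun k => ‖inner ℂ (ρ k h) v‖ ^ 2 :=
      (((hcont h).inner continuous_const).norm).pow 2
    exact hc.integrable_of_hasCompactSupport (HasCompactSupport.of_compactSpace _)
  have hTinner : ∀ v, inner ℂ v (T v) = ((∫ k, ‖inner ℂ (ρ k h) v‖ ^ 2 ∂μ : ℝ) : ℂ) := by
    intro v
    rw [hTdef, ← integral_inner (hintT v), ← integral_complex_ofReal]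
    congr 1; ext k
    rw [inner_smul_right, ← inner_conj_symm v, RCLike.mul_conj]
    simp
  have hTcomm : ∀ k v, T (ρ k v) = ρ k (T v) := by
    intro g v
    rw [hTdef, hTdef, ← ContinuousLinearMap.integral_comp_comm _ (hintT v),
      ← integral_mul_left_eq_self _ g]
    congr 1; ext k
    simp only [map_mul, mul_apply_eq_comp, map_smul, hiso]
  have hTU : ∀ v ∈ U, T v ∈ U := by
    intro v hv
    rw [← Submodule.orthogonal_orthogonal U, Submodule.mem_orthogonal]
    intro w hw
    rw [hTdef, ← integral_inner (hintT v)]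
    apply integral_eq_zero_of_ae
    refine Filter.Eventually.of_forall fun k => ?_
    have := Submodule.inner_left_of_mem_orthogonal (hU k h hhU) hw
    simp [inner_smul_right, this]
  -- `T` is a scalar on `U`
  have hUne : U ≠ ⊥ := by
    rintro rfl
    simp at hhU
    simp [hhU] at hh
  have : Nontrivial U := Submodule.nontrivial_iff_ne_bot.mpr hUne
  obtain ⟨c, hc⟩ := Module.End.exists_eigenvalue (T.restrict hTU)
  obtain ⟨v, hv⟩ := hc.exists_hasEigenvector
  have hscal : ∀ w ∈ U, T w = c • w := by
    let U' : Submodule ℂ E := U ⊓ LinearMap.ker (T - c • LinearMap.id)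
    have hU' : ∀ w, w ∈ U' ↔ w ∈ U ∧ T w = c • w := by
      intro w
      simp [U', Submodule.mem_inf, sub_eq_zero]
    rcases hirr U' inf_le_left (by
      intro k w hw
      rw [hU'] at hw ⊢
      exact ⟨hU k w hw.1, by rw [hTcomm, hw.2, map_smul]⟩) with h1 | h1
    · exfalso
      have : (v : E) ∈ U' := by
        rw [hU']
        refine ⟨v.2, ?_⟩
        have := hv.apply_eq_smul
        simpa using congrArg (Subtype.val) this
      rw [h1] at this
      exact hv.2 (by simpa using this)
    · intro w hw
      rw [← h1, hU'] at hw
      exact hw.2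
  have hkey : ∀ w ∈ U, ((∫ k, ‖inner ℂ (ρ k h) w‖ ^ 2 ∂μ : ℝ) : ℂ) = c * (‖w‖ ^ 2 : ℝ) := by
    intro w hw
    rw [← hTinner, hscal w hw, inner_smul_right, inner_self_eq_norm_sq_to_K]
    simp
  let b := stdOrthonormalBasis ℂ U
  have htr : (1 : ℂ) = c * Module.finrank ℂ U := by
    have h1 : ∀ i, ((∫ k, ‖inner ℂ (ρ k h) (b i : E)‖ ^ 2 ∂μ : ℝ) : ℂ) = c := by
      intro i
      rw [hkey _ (b i).2]
      have := b.orthonormal.1 i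
      rw [Submodule.norm_coe, this]; simp
    have h2 : ∑ i, (∫ k, ‖inner ℂ (ρ k h) (b i : E)‖ ^ 2 ∂μ : ℝ) = 1 := by
      rw [← integral_finsetSum]
      · have : ∀ k, ∑ i, ‖inner ℂ (ρ k h) (b i : E)‖ ^ 2 = 1 := by
          intro k
          have := b.sum_sq_norm_inner_left ⟨ρ k h, hU k h hhU⟩
          have hn : ‖ρ k h‖ = 1 := by
            have := hiso k h h
            rw [inner_self_eq_norm_sq_to_K, inner_self_eq_norm_sq_to_K, hh, RCLike.ofReal_one,
              one_pow] at this
            have h3 : ‖ρ k h‖ ^ 2 = 1 := by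
              apply Complex.ofReal_injective
              rw [Complex.ofReal_pow, Complex.ofReal_one]
              exact this
            nlinarith [norm_nonneg (ρ k h)]
          simpa [Submodule.coe_inner, hn] using this
        simp [this]
      · intro i _
        exact hintR _
    have h3 : ∑ i, ((∫ k, ‖inner ℂ (ρ k h) (b i : E)‖ ^ 2 ∂μ : ℝ) : ℂ) = 1 := by
      exact_mod_cast h2
    rw [Finset.sum_congr rfl (fun i _ => h1 i)] at h3
    simp at h3
    rw [← h3]; ring
  have h5 : ((Module.finrank ℂ U * ∫ k, ‖inner ℂ (ρ k h) u‖ ^ 2 ∂μ : ℝ) : ℂ)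
      = (‖u‖ ^ 2 : ℝ) := by
    push_cast
    have := hkey u hu
    push_cast at this
    rw [this, ← mul_assoc, mul_comm (Module.finrank ℂ U : ℂ), ← htr, one_mul]
  have h6 : Module.finrank ℂ U * ∫ k, ‖inner ℂ (ρ k h) u‖ ^ 2 ∂μ = ‖u‖ ^ 2 := by
    exact_mod_cast h5
  rw [← h6]
  refine mul_le_mul_of_nonneg_left ?_ (Nat.cast_nonneg _)
  calc ∫ k, ‖inner ℂ (ρ k h) u‖ ^ 2 ∂μ ≤ ∫ k, M ∂μ :=
        integral_mono (hintR u)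
          (integrable_const M) hM
    _ = M := by simp

theorem norm_starProjection_sq_le {K : Type*} [Group K] [TopologicalSpace K]
    [IsTopologicalGroup K] [CompactSpace K] {E : Type*} [NormedAddCommGroup E]
    [InnerProductSpace ℂ E] [FiniteDimensional ℂ E] (ρ : K →* (E →L[ℂ] E)) (hρ : Continuous ρ)
    (hiso : ∀ k v w, inner ℂ (ρ k v) (ρ k w) = inner ℂ v w) (P : E → Prop)
    (hP : ∀ U : Submodule ℂ E, U ≠ ⊥ → (∀ k, ∀ u ∈ U, ρ k u ∈ U) → ∃ h ∈ U, ‖h‖ = 1 ∧ P h)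
    (w : E) (M : ℝ) (U : Submodule ℂ E) (hU : ∀ k, ∀ u ∈ U, ρ k u ∈ U)
    (hM : ∀ h ∈ U, ‖h‖ = 1 → P h → ∀ k, ‖inner ℂ (ρ k h) w‖ ^ 2 ≤ M) :
    ‖U.starProjection w‖ ^ 2 ≤ Module.finrank ℂ U * M := by
  have hadj : ∀ k v w, inner ℂ (ρ k v) w = inner ℂ v (ρ k⁻¹ w) := by
    intro k v w
    rw [← hiso k v (ρ k⁻¹ w), ← mul_apply_eq_comp, ← map_mul]
    simp
  induction hn : Module.finrank ℂ U using Nat.strong_induction_on generalizing U with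
  | _ n ih =>
  by_cases hbot : U = ⊥
  · subst hbot
    simp at hn
    simp [← hn]
  by_cases hirr : ∀ U' : Submodule ℂ E, U' ≤ U → (∀ k, ∀ u ∈ U', ρ k u ∈ U') → U' = ⊥ ∨ U' = U
  · obtain ⟨h, hhU, hh, hPh⟩ := hP U hbot hU
    rw [← hn]
    refine norm_sq_le_finrank_mul_of_irreducible ρ hρ hiso U hU hirr h hhU hh _
      (Submodule.starProjection_apply_mem U w) M fun k => ?_
    have : inner ℂ (ρ k h) (U.starProjection w) = inner ℂ (ρ k h) w := by
      rw [← Submodule.inner_starProjection_left_eq_right,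
        Submodule.starProjection_eq_self_iff.mpr (hU k h hhU)]
    rw [this]
    exact hM h hhU hh hPh k
  · push Not at hirr
    obtain ⟨U₁, hle, hinv, hne, hne'⟩ := hirr
    let U₂ := U₁ᗮ ⊓ U
    have hinv₂ : ∀ k, ∀ u ∈ U₂, ρ k u ∈ U₂ := by
      intro k u hu
      refine ⟨?_, hU k u hu.2⟩
      refine (Submodule.mem_orthogonal' _ _).mpr ?_
      intro v hv
      rw [hadj]
      exact Submodule.inner_left_of_mem_orthogonal (hinv _ v hv) hu.1
    have hdim : Module.finrank ℂ U₁ + Module.finrank ℂ U₂ = n := by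
      rw [← hn]; exact Submodule.finrank_add_inf_finrank_orthogonal hle
    have hlt : Module.finrank ℂ U₁ < n := by
      rw [← hn]; exact Submodule.finrank_lt_finrank_of_lt (lt_of_le_of_ne hle hne')
    have hpos : 0 < Module.finrank ℂ U₁ := by
      have : Nontrivial U₁ := Submodule.nontrivial_iff_ne_bot.mpr hne
      exact Module.finrank_pos
    have h1 := ih _ hlt U₁ hinv (fun h hh => hM h (hle hh)) rfl
    have h2 := ih _ (by omega) U₂ hinv₂ (fun h hh => hM h hh.2) rfl
    have hsum : U.starProjection w = U₁.starProjection w + U₂.starProjection w := by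
      refine Submodule.eq_starProjection_of_mem_of_inner_eq_zero
        (U.add_mem (hle (Submodule.starProjection_apply_mem U₁ w))
          (Submodule.starProjection_apply_mem U₂ w).2) ?_
      intro v hv
      have hv1 := Submodule.starProjection_apply_mem U₁ v
      have hv2 : v - U₁.starProjection v ∈ U₂ :=
        ⟨Submodule.sub_starProjection_mem_orthogonal v, U.sub_mem hv (hle hv1)⟩
      have e1 : inner ℂ (w - U₁.starProjection w) (U₁.starProjection v) = 0 :=
        Submodule.starProjection_inner_eq_zero _ _ hv1
      have e2 : inner ℂ (w - U₂.starProjection w) (v - U₁.starProjection v) = 0 :=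
        Submodule.starProjection_inner_eq_zero _ _ hv2
      have e3 : inner ℂ (U₂.starProjection w) (U₁.starProjection v) = 0 :=
        Submodule.inner_left_of_mem_orthogonal hv1 (Submodule.starProjection_apply_mem U₂ w).1
      have e4 : inner ℂ (U₁.starProjection w) (v - U₁.starProjection v) = 0 :=
        Submodule.inner_right_of_mem_orthogonal (Submodule.starProjection_apply_mem U₁ w) hv2.1
      simp only [inner_sub_left, inner_sub_right, inner_add_left] at *
      linear_combination e1 + e2 - e3 - e4
    have hpy : ‖U.starProjection w‖ ^ 2
        = ‖U₁.starProjection w‖ ^ 2 + ‖U₂.starProjection w‖ ^ 2 := by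
      rw [hsum, sq, sq, sq]
      exact norm_add_sq_eq_norm_sq_add_norm_sq_of_inner_eq_zero _ _
        (Submodule.inner_right_of_mem_orthogonal (Submodule.starProjection_apply_mem U₁ w)
          (Submodule.starProjection_apply_mem U₂ w).1)
    rw [hpy, ← hdim]
    push_cast
    linarith

theorem compactSpace_unitaryGroup (n : Type*) [Fintype n] [DecidableEq n] :
    CompactSpace (Matrix.unitaryGroup n ℂ) := by
  refine (isCompact_iff_compactSpace (s := (Matrix.unitaryGroup n ℂ : Set (Matrix n n ℂ)))).mp ?_
  have hsub : (Matrix.unitaryGroup n ℂ : Set (Matrix n n ℂ)) ⊆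
      Set.pi Set.univ fun _ : n => Set.pi Set.univ fun _ : n => Metric.closedBall (0 : ℂ) 1 := by
    intro A hA i _ j _
    simpa using entry_norm_bound_of_unitary hA i j
  refine IsCompact.of_isClosed_subset
    (isCompact_univ_pi fun _ => isCompact_univ_pi fun _ => isCompact_closedBall 0 1) ?_ hsub
  have : (Matrix.unitaryGroup n ℂ : Set (Matrix n n ℂ)) = {A | A * star A = 1} := by
    ext A; exact Matrix.mem_unitaryGroup_iff
  rw [this]
  exact isClosed_eq (by fun_prop) continuous_const

/-- The tensor product of a family of square matrices, indexed by tuples. -/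
def piKron {T : Type*} [Fintype T] {I : T → Type*} (g : ∀ t, Matrix (I t) (I t) ℂ) :
    Matrix (∀ t, I t) (∀ t, I t) ℂ :=
  Matrix.of fun x y => ∏ t, g t (x t) (y t)

section piKron

variable {T : Type*} [Fintype T] {I : T → Type*}

theorem piKron_apply (g : ∀ t, Matrix (I t) (I t) ℂ) (x y : ∀ t, I t) :
    piKron g x y = ∏ t, g t (x t) (y t) := rfl

theorem piKron_mul [DecidableEq T] [∀ t, Fintype (I t)] (g h : ∀ t, Matrix (I t) (I t) ℂ) :
    piKron g * piKron h = piKron fun t => g t * h t := by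
  ext x y
  simp only [Matrix.mul_apply, piKron_apply, Fintype.prod_sum, ← Finset.prod_mul_distrib]

theorem piKron_one [DecidableEq T] [∀ t, DecidableEq (I t)] :
    piKron (fun t => (1 : Matrix (I t) (I t) ℂ)) = 1 := by
  ext x y
  simp only [piKron_apply, Matrix.one_apply]
  rw [Finset.prod_ite_zero]
  simp [funext_iff]

theorem piKron_conjTranspose (g : ∀ t, Matrix (I t) (I t) ℂ) :
    (piKron g)ᴴ = piKron fun t => (g t)ᴴ := by
  ext x y
  simp [piKron_apply, Matrix.conjTranspose_apply]

theorem continuous_piKron {K : Type*} [TopologicalSpace K]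
    (g : K → ∀ t, Matrix (I t) (I t) ℂ) (hg : Continuous g) :
    Continuous fun k => piKron (g k) := by
  refine continuous_matrix fun x y => ?_
  simp only [piKron_apply]
  refine continuous_finsetProd _ fun t _ => ?_
  exact ((continuous_apply t).comp hg).matrix_elem _ _

/-- The action of a matrix on one tensor factor. -/
def factorAct [DecidableEq T] [∀ t, DecidableEq (I t)] (s : T) (A : Matrix (I s) (I s) ℂ) :
    Matrix (∀ t, I t) (∀ t, I t) ℂ :=
  piKron (Function.update (fun _ => 1) s A)

variable [DecidableEq T] [∀ t, DecidableEq (I t)]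

theorem factorAct_one (s : T) : factorAct (I := I) s 1 = 1 := by
  rw [factorAct, Function.update_eq_self_iff.mpr rfl, piKron_one]

theorem factorAct_mul [∀ t, Fintype (I t)] (s : T) (A B : Matrix (I s) (I s) ℂ) :
    factorAct s (A * B) = factorAct s A * factorAct s B := by
  rw [factorAct, factorAct, factorAct, piKron_mul]
  congr 1
  ext1 t
  by_cases h : t = s
  · subst h; simp
  · simp [h]

theorem factorAct_conjTranspose (s : T) (A : Matrix (I s) (I s) ℂ) :
    (factorAct s A)ᴴ = factorAct s Aᴴ := by
  rw [factorAct, factorAct, piKron_conjTranspose]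
  congr 1
  ext1 t
  by_cases h : t = s
  · subst h; simp
  · simp [h]

theorem factorAct_apply (s : T) (A : Matrix (I s) (I s) ℂ) (x y : ∀ t, I t) :
    factorAct s A x y = if ∀ t, t ≠ s → x t = y t then A (x s) (y s) else 0 := by
  rw [factorAct, piKron_apply, ← Finset.mul_prod_erase _ _ (Finset.mem_univ s)]
  have : ∀ t ∈ Finset.univ.erase s, Function.update (fun t => (1 : Matrix (I t) (I t) ℂ)) s A t
      (x t) (y t) = if x t = y t then 1 else 0 := by
    intro t ht
    rw [Function.update_of_ne (Finset.ne_of_mem_erase ht), Matrix.one_apply]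
  rw [Finset.prod_congr rfl this, Finset.prod_ite_zero]
  simp [and_comm]

theorem factorAct_mulVec [∀ t, Fintype (I t)] (s : T) (A : Matrix (I s) (I s) ℂ)
    (ψ : (∀ t, I t) → ℂ) (x : ∀ t, I t) :
    (factorAct s A *ᵥ ψ) x = ∑ i, A (x s) i * ψ (Function.update x s i) := by
  simp only [Matrix.mulVec, dotProduct]
  symm
  refine Finset.sum_of_injOn (fun i => Function.update x s i) ?_ (by simp) ?_ ?_
  · intro i _ j _ hij
    have := congrFun hij s
    simpa using this
  · intro y _ hy
    rw [factorAct_apply, if_neg, zero_mul]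
    intro h
    apply hy
    refine ⟨y s, by simp, ?_⟩
    ext1 t
    by_cases ht : t = s
    · subst ht; simp
    · simp [ht, h t ht]
  · intro i _
    rw [factorAct_apply, if_pos]
    · simp
    · intro t ht; simp [ht]

end piKron

/-- The tensor power of a vector. -/
def tensorPow {X : Type*} (N : ℕ) (ψ : X → ℂ) : (Fin N → X) → ℂ := fun x => ∏ n, ψ (x n)

theorem piKron_mulVec_tensorPow {X : Type*} [Fintype X] (N : ℕ) (g : Matrix X X ℂ) (ψ : X → ℂ) :
    piKron (fun _ : Fin N => g) *ᵥ tensorPow N ψ = tensorPow N (g *ᵥ ψ) := by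
  ext x
  simp only [Matrix.mulVec, dotProduct, piKron_apply, tensorPow, Fintype.prod_sum,
    ← Finset.prod_mul_distrib]

theorem star_tensorPow_dotProduct {X : Type*} [Fintype X] (N : ℕ) (φ ψ : X → ℂ) :
    star (tensorPow N φ) ⬝ᵥ tensorPow N ψ = (star φ ⬝ᵥ ψ) ^ N := by
  have : (star φ ⬝ᵥ ψ) ^ N = ∏ _n : Fin N, ∑ j, star φ j * ψ j := by
    simp [dotProduct]
  rw [this, Fintype.prod_sum]
  simp [dotProduct, tensorPow, Finset.prod_mul_distrib]

section highestWeight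

variable {S : Type*} [Fintype S] [DecidableEq S] {d : S → ℕ}

/-- The action on the `N`-th tensor power of a matrix acting on one tensor factor. -/
def powAct (N : ℕ) (s : S) (A : Matrix (Fin (d s)) (Fin (d s)) ℂ) :
    Matrix (Fin N → ∀ t, Fin (d t)) (Fin N → ∀ t, Fin (d t)) ℂ :=
  piKron fun _ : Fin N => factorAct s A

/-- How often the letter `i` occurs in the `s`-th row of the word `x`. -/
def letterCount {N : ℕ} (s : S) (i : Fin (d s)) (x : Fin N → ∀ t, Fin (d t)) : ℕ :=
  (Finset.univ.filter fun n => x n s = i).card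

/-- The sum of all letters of the word `x`. -/
def letterSum {N : ℕ} (x : Fin N → ∀ t, Fin (d t)) : ℕ := ∑ s, ∑ n, (x n s : ℕ)

omit [DecidableEq S] in
theorem letterSum_eq {N : ℕ} (x : Fin N → ∀ t, Fin (d t)) :
    letterSum x = ∑ s, ∑ i : Fin (d s), letterCount s i x * (i : ℕ) := by
  refine Finset.sum_congr rfl fun s _ => ?_
  rw [← Finset.sum_fiberwise (s := Finset.univ) (g := fun n => x n s)]
  refine Finset.sum_congr rfl fun i _ => ?_
  rw [Finset.sum_congr rfl (g := fun _ => (i : ℕ))]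
  · simp [letterCount]
  · intro n hn; rw [(Finset.mem_filter.mp hn).2]

omit [Fintype S] [DecidableEq S] in
theorem sum_letterCount {N : ℕ} (s : S) (x : Fin N → ∀ t, Fin (d t)) :
    ∑ i : Fin (d s), letterCount s i x = N := by
  have := Finset.card_eq_sum_card_fiberwise (f := fun n => x n s) (s := Finset.univ)
    (t := Finset.univ) (by intro; simp)
  simpa [letterCount] using this.symm

omit [Fintype S] [DecidableEq S] in
theorem letterCount_le {N : ℕ} (s : S) (i : Fin (d s)) (x : Fin N → ∀ t, Fin (d t)) :
    letterCount s i x ≤ N := by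
  exact (Finset.card_filter_le _ _).trans_eq (by simp)

theorem powAct_mul (N : ℕ) (s : S) (A B : Matrix (Fin (d s)) (Fin (d s)) ℂ) :
    powAct (d := d) N s (A * B) = powAct N s A * powAct N s B := by
  rw [powAct, powAct, powAct, piKron_mul, factorAct_mul]

theorem factorAct_diagonal (s : S) (t : Fin (d s) → ℂ) :
    factorAct (I := fun s => Fin (d s)) s (Matrix.diagonal t)
      = Matrix.diagonal fun x => t (x s) := by
  ext x y
  rw [factorAct_apply, Matrix.diagonal_apply, Matrix.diagonal_apply]
  by_cases h : x = y
  · subst h; simp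
  · rw [if_neg h]
    split_ifs with h1 h2
    · exact absurd (funext fun t => if ht : t = s then ht ▸ h2 else h1 t ht) h
    · rfl
    · rfl

theorem powAct_diagonal_mulVec (N : ℕ) (s : S) (t : Fin (d s) → ℂ)
    (u : (Fin N → ∀ t, Fin (d t)) → ℂ) :
    powAct N s (Matrix.diagonal t) *ᵥ u = (fun x => ∏ n, t (x n s)) * u := by
  have : powAct (d := d) N s (Matrix.diagonal t) = Matrix.diagonal fun x => ∏ n, t (x n s) := by
    ext x y
    rw [powAct, piKron_apply, factorAct_diagonal]
    simp only [Matrix.diagonal_apply]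
    rw [Finset.prod_ite_zero]
    simp [funext_iff]
  rw [this]
  ext x
  simp [Matrix.mulVec_diagonal]

omit [Fintype S] [DecidableEq S] in
theorem prod_update_one {N : ℕ} (s : S) (i : Fin (d s)) (z : ℂ) (x : Fin N → ∀ t, Fin (d t)) :
    ∏ n, Function.update (1 : Fin (d s) → ℂ) i z (x n s) = z ^ letterCount s i x := by
  simp only [Function.update_apply, Pi.one_apply]
  rw [Finset.prod_ite]
  simp [letterCount]

theorem mem_unitaryGroup_diagonal {n : Type*} [Fintype n] [DecidableEq n] (t : n → ℂ)
    (ht : ∀ i, ‖t i‖ = 1) : Matrix.diagonal t ∈ Matrix.unitaryGroup n ℂ := by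
  rw [Matrix.mem_unitaryGroup_iff, star_eq_conjTranspose, Matrix.diagonal_conjTranspose,
    Matrix.diagonal_mul_diagonal, ← Matrix.diagonal_one]
  congr 1
  ext i
  simp [Complex.mul_conj, Complex.normSq_eq_norm_sq, ht]

/-- The functions on words such that multiplication by them preserves the subspace `U`. -/
def multiplierAlgebra {Y : Type*} (U : Submodule ℂ (Y → ℂ)) : Subalgebra ℂ (Y → ℂ) where
  carrier := {g | ∀ u ∈ U, g * u ∈ U}
  mul_mem' := by
    intro a b ha hb u hu
    rw [mul_assoc]
    exact ha _ (hb _ hu)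
  add_mem' := by
    intro a b ha hb u hu
    rw [add_mul]
    exact U.add_mem (ha _ hu) (hb _ hu)
  algebraMap_mem' := by
    intro r u hu
    rw [← Algebra.smul_def]
    exact U.smul_mem r hu

variable {N : ℕ} {U : Submodule ℂ ((Fin N → ∀ t, Fin (d t)) → ℂ)}

theorem pow_letterCount_mem (hU : ∀ s, ∀ A ∈ Matrix.unitaryGroup (Fin (d s)) ℂ, ∀ u ∈ U,
    powAct N s A *ᵥ u ∈ U) (s : S) (i : Fin (d s)) (z : ℂ) (hz : ‖z‖ = 1) :
    (fun x => z ^ letterCount s i x) ∈ multiplierAlgebra U := by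
  intro u hu
  have := hU s (Matrix.diagonal (Function.update 1 i z)) (mem_unitaryGroup_diagonal _ fun j => by
    by_cases h : j = i
    · subst h; simpa
    · simp [h]) u hu
  rw [powAct_diagonal_mulVec] at this
  simpa only [prod_update_one] using this

theorem indicator_letterCount_mem (hU : ∀ s, ∀ A ∈ Matrix.unitaryGroup (Fin (d s)) ℂ, ∀ u ∈ U,
    powAct N s A *ᵥ u ∈ U) (s : S) (i : Fin (d s)) (m : ℕ) (hm : m ≤ N) :
    (fun x => if letterCount s i x = m then (1 : ℂ) else 0) ∈ multiplierAlgebra U := by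
  obtain ⟨ω, hω⟩ : ∃ ω : ℂ, IsPrimitiveRoot ω (N + 1) :=
    ⟨_, Complex.isPrimitiveRoot_exp (N + 1) (by omega)⟩
  have hinj : ∀ a ≤ N, ∀ b ≤ N, ω ^ a = ω ^ b → a = b := fun a ha b hb h =>
    hω.pow_inj (by omega) (by omega) h
  have key : (fun x : Fin N → ∀ t, Fin (d t) => if letterCount s i x = m then (1 : ℂ) else 0)
      = ∏ k ∈ (Finset.range (N + 1)).erase m,
        ((algebraMap ℂ _ (ω ^ m - ω ^ k)⁻¹) *
          ((fun x => ω ^ letterCount s i x) - algebraMap ℂ _ (ω ^ k))) := by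
    ext x
    simp only [Finset.prod_apply, Pi.mul_apply, Pi.sub_apply, Pi.algebraMap_apply,
      Algebra.algebraMap_self, RingHom.id_apply]
    split_ifs with h
    · rw [h]
      symm
      apply Finset.prod_eq_one
      intro k hk
      rw [Finset.mem_erase, Finset.mem_range] at hk
      refine inv_mul_cancel₀ (sub_ne_zero.mpr fun h' => hk.1 ?_)
      exact (hinj _ hm _ (by omega) h').symm
    · symm
      apply Finset.prod_eq_zero (i := letterCount s i x)
      · rw [Finset.mem_erase, Finset.mem_range]
        exact ⟨h, Nat.lt_succ_of_le (letterCount_le s i x)⟩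
      · simp
  rw [key]
  refine prod_mem fun k _ => mul_mem (Subalgebra.algebraMap_mem _ _)
    (sub_mem (pow_letterCount_mem hU s i ω ?_) (Subalgebra.algebraMap_mem _ _))
  exact hω.norm'_eq_one (by omega)

theorem powAct_diagonal_mem (hU : ∀ s, ∀ A ∈ Matrix.unitaryGroup (Fin (d s)) ℂ, ∀ u ∈ U,
    powAct N s A *ᵥ u ∈ U) (s : S) (t : Fin (d s) → ℂ) (u) (hu : u ∈ U) :
    powAct N s (Matrix.diagonal t) *ᵥ u ∈ U := by
  rw [powAct_diagonal_mulVec]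
  suffices h : (fun x : Fin N → ∀ t, Fin (d t) => ∏ n, t (x n s)) ∈ multiplierAlgebra U from
    h u hu
  have key : (fun x : Fin N → ∀ t, Fin (d t) => ∏ n, t (x n s))
      = ∏ i, ∑ m ∈ Finset.range (N + 1), algebraMap ℂ _ (t i ^ m) *
        (fun x => if letterCount s i x = m then (1 : ℂ) else 0) := by
    ext x
    simp only [Finset.prod_apply, Finset.sum_apply, Pi.mul_apply, Pi.algebraMap_apply,
      Algebra.algebraMap_self, RingHom.id_apply]
    rw [← Finset.prod_fiberwise (s := Finset.univ) (g := fun n => x n s)]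
    refine Finset.prod_congr rfl fun i _ => ?_
    rw [Finset.sum_eq_single (letterCount s i x)]
    · rw [Finset.prod_congr rfl (g := fun _ => t i)]
      · simp [letterCount]
      · intro n hn; rw [(Finset.mem_filter.mp hn).2]
    · intro m _ hm; simp [hm.symm]
    · intro h
      exact absurd (Finset.mem_range.mpr (Nat.lt_succ_of_le (letterCount_le s i x))) h
  rw [key]
  refine prod_mem fun i _ => sum_mem fun m hm => mul_mem (Subalgebra.algebraMap_mem _ _)
    (indicator_letterCount_mem hU s i m ?_)
  rw [Finset.mem_range] at hm; omega

theorem powAct_isHermitian_mem (hU : ∀ s, ∀ A ∈ Matrix.unitaryGroup (Fin (d s)) ℂ, ∀ u ∈ U,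
    powAct N s A *ᵥ u ∈ U) (s : S) (A : Matrix (Fin (d s)) (Fin (d s)) ℂ) (hA : A.IsHermitian)
    (u) (hu : u ∈ U) : powAct N s A *ᵥ u ∈ U := by
  rw [hA.spectral_theorem, Unitary.conjStarAlgAut_apply, powAct_mul, powAct_mul,
    ← Matrix.mulVec_mulVec, ← Matrix.mulVec_mulVec]
  refine hU s _ hA.eigenvectorUnitary.2 _ (powAct_diagonal_mem hU s _ _ (hU s _ ?_ _ hu))
  exact (star hA.eigenvectorUnitary).2

/-- The permutation matrix of a transposition. -/
def swapMatrix {n : Type*} [DecidableEq n] (i j : n) : Matrix n n ℂ :=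
  Matrix.of fun k l => if Equiv.swap i j k = l then 1 else 0

theorem swapMatrix_isHermitian {n : Type*} [DecidableEq n] (i j : n) :
    (swapMatrix i j).IsHermitian := by
  ext k l
  simp only [swapMatrix, Matrix.conjTranspose_apply, Matrix.of_apply]
  have : Equiv.swap i j l = k ↔ Equiv.swap i j k = l := by
    constructor <;> (intro h; rw [← h]; simp)
  simp only [this]
  split_ifs <;> simp

theorem mul_swapMatrix_apply {n : Type*} [Fintype n] [DecidableEq n] (i j : n) (A : Matrix n n ℂ)
    (k l : n) : (A * swapMatrix i j) k l = A k (Equiv.swap i j l) := by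
  rw [Matrix.mul_apply, Finset.sum_eq_single (Equiv.swap i j l)]
  · simp [swapMatrix]
  · intro m _ hm
    have : Equiv.swap i j m ≠ l := by
      rintro rfl; simp at hm
    simp [swapMatrix, this]
  · simp

theorem powAct_transvection_mem (hU : ∀ s, ∀ A ∈ Matrix.unitaryGroup (Fin (d s)) ℂ, ∀ u ∈ U,
    powAct N s A *ᵥ u ∈ U) (s : S) (i j : Fin (d s)) (hij : j ≠ i) (z : ℂ)
    (u) (hu : u ∈ U) : powAct N s (1 + Matrix.single j i z) *ᵥ u ∈ U := by
  by_cases hz : z = 0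
  · subst hz
    rw [Matrix.single_zero, add_zero]
    exact hU s 1 (one_mem _) u hu
  have h1 : ((1 : Matrix (Fin (d s)) (Fin (d s)) ℂ) + Matrix.single j i 1)
      = (swapMatrix i j + Matrix.single j j 1) * swapMatrix i j := by
    ext k l
    rw [mul_swapMatrix_apply]
    simp only [Matrix.add_apply, swapMatrix, Matrix.of_apply, Matrix.single_apply,
      Matrix.one_apply, (Equiv.swap i j).injective.eq_iff]
    congr 2
    rw [eq_comm (a := j) (b := Equiv.swap i j l), Equiv.swap_apply_eq_iff, Equiv.swap_apply_right,
      eq_comm (a := l)]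
  have h2 : (1 : Matrix (Fin (d s)) (Fin (d s)) ℂ) + Matrix.single j i z
      = Matrix.diagonal (Function.update 1 j z) * ((swapMatrix i j + Matrix.single j j 1) *
        swapMatrix i j) * Matrix.diagonal (Function.update 1 j z⁻¹) := by
    rw [← h1]
    ext k l
    rw [Matrix.mul_diagonal, Matrix.diagonal_mul]
    simp only [Matrix.add_apply, Matrix.single_apply, Matrix.one_apply, Function.update_apply,
      Pi.one_apply]
    by_cases hk : k = j
    · subst hk
      by_cases hl : k = l
      · subst hl; simp [hz, hij.symm]
      · have : l ≠ k := fun h => hl h.symm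
        simp [hl, this]
    · have : j ≠ k := fun h => hk h.symm
      by_cases hl : k = l
      · subst hl; simp [hk, this]
      · simp [hl, this]
  rw [h2, powAct_mul, powAct_mul, powAct_mul]
  simp only [← Matrix.mulVec_mulVec]
  refine powAct_diagonal_mem hU s _ _ (powAct_isHermitian_mem hU s _ ?_ _
    (powAct_isHermitian_mem hU s _ (swapMatrix_isHermitian i j) _
      (powAct_diagonal_mem hU s _ _ hu)))
  refine (swapMatrix_isHermitian i j).add ?_
  ext k l
  simp [Matrix.single_apply, and_comm]

theorem exists_highestWeight_vector (hU : ∀ s, ∀ A ∈ Matrix.unitaryGroup (Fin (d s)) ℂ, ∀ u ∈ U,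
    powAct N s A *ᵥ u ∈ U) (hne : U ≠ ⊥) :
    ∃ h ∈ U, h ≠ 0 ∧ ∃ lam : ∀ s, Fin (d s) → ℕ, (∀ s, Antitone (lam s)) ∧
      (∀ s, ∑ i, lam s i = N) ∧
      (∀ x, h x ≠ 0 → ∀ s i, letterCount s i x = lam s i) ∧
      ∀ s (i j : Fin (d s)), j < i → ∀ z, powAct N s (1 + Matrix.single j i z) *ᵥ h = h := by
  classical
  obtain ⟨u₀, hu₀, hu₀ne⟩ := Submodule.exists_mem_ne_zero_of_ne_bot hne
  obtain ⟨x₁, hx₁⟩ := Function.ne_iff.mp hu₀ne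
  obtain ⟨x₀, hx₀, hmin⟩ := Finset.exists_min_image
    (Finset.univ.filter fun x => ∃ u ∈ U, u x ≠ 0) letterSum ⟨x₁, by simpa using ⟨u₀, hu₀, hx₁⟩⟩
  simp only [Finset.mem_filter, Finset.mem_univ, true_and] at hx₀ hmin
  obtain ⟨u, hu, hux⟩ := hx₀
  let e : (Fin N → ∀ t, Fin (d t)) → ℂ := ∏ s, ∏ i, fun x =>
    if letterCount s i x = letterCount s i x₀ then (1 : ℂ) else 0
  have he : e ∈ multiplierAlgebra U := prod_mem fun s _ => prod_mem fun i _ =>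
    indicator_letterCount_mem hU s i _ (letterCount_le s i x₀)
  have he₀ : e x₀ = 1 := by simp [e, Finset.prod_apply]
  have he' : ∀ x, e x ≠ 0 → ∀ s i, letterCount s i x = letterCount s i x₀ := by
    intro x hx s i
    simp only [e, Finset.prod_apply, Finset.prod_ne_zero_iff] at hx
    have := hx s (Finset.mem_univ _) i (Finset.mem_univ _)
    by_contra hcon
    simp [hcon] at this
  have hhU : e * u ∈ U := he u hu
  have hh₀ : (e * u) x₀ ≠ 0 := by simpa [he₀] using hux
  have hcount : ∀ x, (e * u) x ≠ 0 → ∀ s i, letterCount s i x = letterCount s i x₀ :=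
    fun x hx => he' x (left_ne_zero_of_mul hx)
  have hsum : ∀ x, (e * u) x ≠ 0 → letterSum x = letterSum x₀ := by
    intro x hx
    rw [letterSum_eq, letterSum_eq]
    simp only [hcount x hx]
  refine ⟨e * u, hhU, fun h0 => hh₀ (by rw [h0]; rfl), fun s i => letterCount s i x₀, ?_,
    fun s => sum_letterCount s x₀, hcount, ?_⟩
  · intro s j i hji
    rcases hji.eq_or_lt with rfl | hlt
    · exact le_rfl
    by_contra! hcon
    let x : Fin N → ∀ t, Fin (d t) := fun n => Function.update (x₀ n) s (Equiv.swap i j (x₀ n s))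
    have hx : (powAct N s (swapMatrix i j) *ᵥ (e * u)) x = (e * u) x₀ := by
      rw [Matrix.mulVec, dotProduct, Finset.sum_eq_single x₀]
      · rw [powAct, piKron_apply, Finset.prod_eq_one, one_mul]
        intro n _
        rw [factorAct_apply, if_pos]
        · simp [x, swapMatrix]
        · intro t ht; simp [x, ht]
      · intro y _ hy
        obtain ⟨n, hn⟩ := Function.ne_iff.mp hy
        rw [powAct, piKron_apply, Finset.prod_eq_zero (i := n) (Finset.mem_univ _), zero_mul]
        rw [factorAct_apply]
        split_ifs with h1
        · have : ¬ (x₀ n s = y n s) := by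
            intro h2
            apply hn
            ext1 t
            by_cases ht : t = s
            · subst ht; exact h2.symm
            · rw [← h1 t ht]; simp [x, ht]
          simp [x, swapMatrix, this]
        · rfl
      · simp
    have hle := hmin x ⟨_, powAct_isHermitian_mem hU s _ (swapMatrix_isHermitian i j) _ hhU, by
      rw [hx]; exact hh₀⟩
    have hdiff : (letterSum x : ℤ) - letterSum x₀
        = ((i : ℤ) - j) * (letterCount s j x₀ - letterCount s i x₀) := by
      rw [letterSum, letterSum]
      push_cast
      rw [← Finset.sum_sub_distrib, Finset.sum_eq_single s]
      · rw [← Finset.sum_sub_distrib]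
        have : ∀ n, ((x n s : ℕ) : ℤ) - (x₀ n s : ℕ)
            = (if x₀ n s = j then ((i : ℤ) - j) else 0) - (if x₀ n s = i then ((i : ℤ) - j) else 0) := by
          intro n
          simp only [x, Function.update_self, Equiv.swap_apply_def]
          by_cases h1 : x₀ n s = i
          · have : i ≠ j := hlt.ne'
            simp [h1, this]
          · by_cases h2 : x₀ n s = j
            · have : j ≠ i := hlt.ne
              simp [h2, this]
            · simp [h1, h2]
        rw [Finset.sum_congr rfl fun n _ => this n, Finset.sum_sub_distrib, ← Finset.sum_filter,
          ← Finset.sum_filter]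
        simp [letterCount]
        ring
      · intro t _ ht
        simp [x, ht]
      · simp
    have h1 : (0 : ℤ) < (i : ℤ) - j := by
      have : (j : ℕ) < i := hlt
      omega
    have h2 : ((letterCount s j x₀ : ℤ) - letterCount s i x₀) < 0 := by
      omega
    have h3 := mul_neg_of_pos_of_neg h1 h2
    omega
  · intro s i j hji z
    have hvU := powAct_transvection_mem hU s i j hji.ne z _ hhU
    have hterm : ∀ x y, powAct N s (1 + Matrix.single j i z) x y * (e * u) y ≠ 0 → y ≠ x →
        letterSum x < letterSum x₀ := by
      intro x y hxy hne
      rw [← hsum y (right_ne_zero_of_mul hxy)]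
      have h1 := left_ne_zero_of_mul hxy
      rw [powAct, piKron_apply, Finset.prod_ne_zero_iff] at h1
      have h2 : ∀ n, x n = y n ∨ ((∀ t, t ≠ s → x n t = y n t) ∧ x n s = j ∧ y n s = i) := by
        intro n
        have := h1 n (Finset.mem_univ _)
        rw [factorAct_apply] at this
        split_ifs at this with h3
        · by_cases h4 : x n s = y n s
          · left
            ext1 t
            by_cases ht : t = s
            · subst ht; exact h4
            · exact h3 t ht
          · right
            refine ⟨h3, ?_⟩
            by_contra hcon
            apply this
            rw [Matrix.add_apply, Matrix.one_apply_ne h4, Matrix.single_apply, if_neg, add_zero]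
            rintro ⟨h5, h6⟩
            exact hcon ⟨h5.symm, h6.symm⟩
        · exact absurd rfl this
      obtain ⟨n₀, hn₀⟩ := Function.ne_iff.mp hne
      have hle : ∀ n t, (x n t : ℕ) ≤ y n t := by
        intro n t
        rcases h2 n with h3 | ⟨h3, h4, h5⟩
        · rw [h3]
        · by_cases ht : t = s
          · subst ht; rw [h4, h5]; exact hji.le
          · rw [h3 t ht]
      rw [letterSum, letterSum]
      refine Finset.sum_lt_sum (fun t _ => Finset.sum_le_sum fun n _ => hle n t)
        ⟨s, Finset.mem_univ _, Finset.sum_lt_sum (fun n _ => hle n s) ⟨n₀, Finset.mem_univ _, ?_⟩⟩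
      rcases h2 n₀ with h3 | ⟨h3, h4, h5⟩
      · exact absurd h3.symm hn₀
      · rw [h4, h5]; exact hji
    ext x
    by_cases hx : letterSum x < letterSum x₀
    · have h1 : ∀ v ∈ U, v x = 0 := by
        intro v hv
        by_contra hcon
        exact absurd (hmin x ⟨v, hv, hcon⟩) (not_le.mpr hx)
      rw [h1 _ hvU, h1 _ hhU]
    · rw [Matrix.mulVec, dotProduct, Finset.sum_eq_single x]
      · rw [powAct, piKron_apply, Finset.prod_eq_one, one_mul]
        intro n _
        rw [factorAct_apply, if_pos (fun _ _ => rfl), Matrix.add_apply, Matrix.one_apply_eq,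
          Matrix.single_apply, if_neg, add_zero]
        rintro ⟨h1, h2⟩
        exact hji.ne (h1.trans h2.symm)
      · intro y _ hy
        by_contra hcon
        exact hx (hterm x y hcon hy)
      · simp

end highestWeight

/-- The squared Euclidean norm of a complex vector. -/
def sqNorm {X : Type*} [Fintype X] (ψ : X → ℂ) : ℝ := ∑ x, ‖ψ x‖ ^ 2

theorem ofReal_sqNorm {X : Type*} [Fintype X] (ψ : X → ℂ) :
    ((sqNorm ψ : ℝ) : ℂ) = star ψ ⬝ᵥ ψ := by
  simp [sqNorm, dotProduct, Complex.conj_mul']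

theorem sqNorm_nonneg {X : Type*} [Fintype X] (ψ : X → ℂ) : 0 ≤ sqNorm ψ :=
  Finset.sum_nonneg fun _ _ => by positivity

theorem sqNorm_eq_zero {X : Type*} [Fintype X] {ψ : X → ℂ} : sqNorm ψ = 0 ↔ ψ = 0 := by
  rw [sqNorm, Finset.sum_eq_zero_iff_of_nonneg fun _ _ => by positivity]
  simp [funext_iff]

theorem sqNorm_smul {X : Type*} [Fintype X] (c : ℂ) (ψ : X → ℂ) :
    sqNorm (c • ψ) = ‖c‖ ^ 2 * sqNorm ψ := by
  simp [sqNorm, Finset.mul_sum, mul_pow]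

theorem continuous_sqNorm {X : Type*} [Fintype X] : Continuous (sqNorm : (X → ℂ) → ℝ) := by
  unfold sqNorm; fun_prop

theorem isCompact_sqNorm_eq_one {X : Type*} [Fintype X] :
    IsCompact {ψ : X → ℂ | sqNorm ψ = 1} := by
  refine Metric.isCompact_of_isClosed_isBounded
    (isClosed_eq continuous_sqNorm continuous_const) ?_
  refine (Metric.isBounded_closedBall (x := (0 : X → ℂ)) (r := 1)).subset fun ψ hψ => ?_
  rw [mem_closedBall_zero_iff, pi_norm_le_iff_of_nonneg zero_le_one]
  intro x
  have h1 : ‖ψ x‖ ^ 2 ≤ 1 := by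
    rw [← (show sqNorm ψ = 1 from hψ)]
    exact Finset.single_le_sum (f := fun x => ‖ψ x‖ ^ 2) (fun _ _ => by positivity)
      (Finset.mem_univ x)
  nlinarith [norm_nonneg (ψ x)]

section marginal

variable {T : Type*} [Fintype T] [DecidableEq T] {I : T → Type*} [∀ t, Fintype (I t)]
  [∀ t, DecidableEq (I t)]

/-- The reduced density matrix of a pure state at one tensor factor. -/
def marginal (φ : (∀ t, I t) → ℂ) (s : T) : Matrix (I s) (I s) ℂ :=
  Matrix.of fun i j => ∑ x, if x s = i then φ x * star (φ (Function.update x s j)) else 0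

theorem marginal_isHermitian (φ : (∀ t, I t) → ℂ) (s : T) : (marginal φ s).IsHermitian := by
  ext i j
  simp only [Matrix.conjTranspose_apply, marginal, Matrix.of_apply]
  rw [star_sum, ← Finset.sum_filter]
  simp only [apply_ite star, star_mul, star_star, star_zero]
  rw [← Finset.sum_filter]
  refine Finset.sum_bij' (fun x _ => Function.update x s i) (fun x _ => Function.update x s j)
    ?_ ?_ ?_ ?_ ?_
  · intro x hx; simp
  · intro x hx; simp
  · intro x hx
    have := (Finset.mem_filter.mp hx).2
    simp [← this]
  · intro x hx
    have := (Finset.mem_filter.mp hx).2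
    simp [← this]
  · intro x hx
    have := (Finset.mem_filter.mp hx).2
    simp [← this]

theorem star_dotProduct_factorAct (φ : (∀ t, I t) → ℂ) (s : T) (A : Matrix (I s) (I s) ℂ) :
    star φ ⬝ᵥ (factorAct s A *ᵥ φ) = (A * marginal φ s).trace := by
  have h1 : (A * marginal φ s).trace = ∑ i, ∑ j, A i j * star (marginal φ s i j) := by
    simp only [Matrix.trace, Matrix.diag, Matrix.mul_apply]
    refine Finset.sum_congr rfl fun i _ => Finset.sum_congr rfl fun j _ => ?_
    rw [(marginal_isHermitian φ s).apply]
  rw [h1]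
  simp only [dotProduct, factorAct_mulVec, marginal, Matrix.of_apply, star_sum,
    Finset.mul_sum]
  rw [← Finset.sum_fiberwise (s := Finset.univ) (g := fun x : ∀ t, I t => x s)]
  refine Finset.sum_congr rfl fun i _ => ?_
  rw [Finset.sum_comm]
  refine Finset.sum_congr rfl fun j _ => ?_
  rw [Finset.sum_filter]
  refine Finset.sum_congr rfl fun x _ => ?_
  split_ifs with h
  · subst h; simp; ring
  · simp

theorem trace_marginal (φ : (∀ t, I t) → ℂ) (s : T) :
    (marginal φ s).trace = sqNorm φ := by
  rw [ofReal_sqNorm]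
  have := star_dotProduct_factorAct φ s 1
  rw [factorAct_one, Matrix.one_mulVec, one_mul] at this
  exact this.symm

theorem sqNorm_factorAct (φ : (∀ t, I t) → ℂ) (s : T) (B : Matrix (I s) (I s) ℂ) :
    ((sqNorm (factorAct s B *ᵥ φ) : ℝ) : ℂ) = (Bᴴ * B * marginal φ s).trace := by
  rw [← star_dotProduct_factorAct, factorAct_mul, ← factorAct_conjTranspose, ofReal_sqNorm,
    Matrix.star_mulVec, ← Matrix.mulVec_mulVec, Matrix.dotProduct_mulVec (star φ)]

theorem marginal_piKron_mulVec (φ : (∀ t, I t) → ℂ) (k : ∀ t, Matrix (I t) (I t) ℂ)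
    (hk : ∀ t, k t ∈ Matrix.unitaryGroup (I t) ℂ) (s : T) :
    marginal (piKron k *ᵥ φ) s = k s * marginal φ s * (k s)ᴴ := by
  rw [Matrix.ext_iff_trace_mul_left]
  intro A
  rw [← star_dotProduct_factorAct]
  have h1 : (A * (k s * marginal φ s * (k s)ᴴ)).trace
      = ((k s)ᴴ * A * k s * marginal φ s).trace := by
    rw [← Matrix.mul_assoc, ← Matrix.mul_assoc, Matrix.trace_mul_comm]
    simp only [Matrix.mul_assoc]
  rw [h1, ← star_dotProduct_factorAct, Matrix.star_mulVec, Matrix.mulVec_mulVec,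
    ← Matrix.dotProduct_mulVec, Matrix.mulVec_mulVec, piKron_conjTranspose]
  congr 2
  rw [factorAct, piKron_mul, piKron_mul, factorAct]
  congr 1
  ext1 t
  by_cases h : t = s
  · subst h; simp [Matrix.mul_assoc]
  · have := Matrix.mem_unitaryGroup_iff'.mp (hk t)
    rw [star_eq_conjTranspose] at this
    simp [h, this]

theorem continuous_marginal (s : T) :
    Continuous fun φ : (∀ t, I t) → ℂ => marginal φ s := by
  refine continuous_matrix fun i j => ?_
  simp only [marginal, Matrix.of_apply]
  refine continuous_finsetSum _ fun x _ => ?_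
  split_ifs
  · fun_prop
  · fun_prop

end marginal

section firstOrder

variable {S : Type*} [Fintype S] [DecidableEq S] {d : S → ℕ}

/-- The vector `φ` is shortest in its orbit, with weight `q`, along the elementary lower triangular
matrices acting on the tensor factors. -/
structure IsShortest (φ : (∀ s, Fin (d s)) → ℂ) (q : ∀ s, Fin (d s) → ℝ) : Prop where
  sqNorm_eq : sqNorm φ = 1
  transvection : ∀ s (i j : Fin (d s)), j < i → ∀ z,
    1 ≤ sqNorm (factorAct s (1 + Matrix.single i j z) *ᵥ φ)
  dilation : ∀ s (i : Fin (d s)) (t : ℝ), 0 < t →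
    t ^ (2 * q s i) ≤ sqNorm (factorAct s (Matrix.diagonal (Function.update 1 i (t : ℂ))) *ᵥ φ)

theorem IsShortest.marginal_eq {φ : (∀ s, Fin (d s)) → ℂ} {q : ∀ s, Fin (d s) → ℝ}
    (h : IsShortest φ q) (s : S) :
    marginal φ s = Matrix.diagonal fun i => (q s i : ℂ) := by
  set R := marginal φ s with hR
  have hherm : R.IsHermitian := marginal_isHermitian φ s
  have htr : R.trace = 1 := by rw [hR, trace_marginal, h.sqNorm_eq]; simp
  have hreal : ∀ i, R i i = ((R i i).re : ℂ) := by
    intro i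
    have := hherm.apply i i
    exact (Complex.conj_eq_iff_re.mp this).symm
  have hoff : ∀ i j, j < i → R j i = 0 := by
    intro i j hji
    by_contra hne
    have hexp : ∀ z : ℂ, sqNorm (factorAct s (1 + Matrix.single i j z) *ᵥ φ)
        = 1 + 2 * (z * R j i).re + ‖z‖ ^ 2 * (R j j).re := by
      intro z
      apply Complex.ofReal_injective
      rw [sqNorm_factorAct, ← hR]
      have e1 : (1 + Matrix.single i j z)ᴴ * (1 + Matrix.single i j z)
          = 1 + Matrix.single i j z + Matrix.single j i (star z)
            + Matrix.single j j (star z * z) := by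
        rw [Matrix.conjTranspose_add, Matrix.conjTranspose_one, Matrix.conjTranspose_single]
        simp [add_mul, mul_add]
        abel
      rw [e1, add_mul, add_mul, add_mul, Matrix.trace_add, Matrix.trace_add, Matrix.trace_add,
        one_mul, htr, Matrix.trace_single_mul, Matrix.trace_single_mul, Matrix.trace_single_mul,
        ← hherm.apply i j, hreal j]
      have e2 : star z * star (R j i) = star (z * R j i) := by rw [star_mul, mul_comm]
      have e3 : z * R j i + star (z * R j i) = ((2 * (z * R j i).re : ℝ) : ℂ) :=
        Complex.add_conj _
      have e4 : star z * z = ((‖z‖ ^ 2 : ℝ) : ℂ) := by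
        rw [Complex.star_def, Complex.conj_mul']; push_cast; rfl
      simp only [smul_eq_mul]
      rw [e2, e4, add_assoc (1 : ℂ), e3]
      push_cast
      simp
    set r := ‖R j i‖ ^ 2 with hr
    have hrpos : 0 < r := by positivity
    have key : ∀ t : ℝ, 0 ≤ -2 * t * r + t ^ 2 * r * (R j j).re := by
      intro t
      have := h.transvection s i j hji (-(t : ℂ) * star (R j i))
      rw [hexp] at this
      have e1 : (-(t : ℂ) * star (R j i) * R j i).re = - t * r := by
        rw [mul_assoc, Complex.star_def, Complex.conj_mul', ← Complex.ofReal_pow, ← hr,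
          ← Complex.ofReal_neg, ← Complex.ofReal_mul, Complex.ofReal_re]
      have e2 : ‖-(t : ℂ) * star (R j i)‖ ^ 2 = t ^ 2 * r := by
        rw [norm_mul, norm_star, mul_pow, ← hr]; simp
      rw [e1, e2] at this
      linarith
    have h1 := key (1 / (|(R j j).re| + 1))
    have hpos : 0 < |(R j j).re| + 1 := by positivity
    have h2 : -2 * (1 / (|(R j j).re| + 1)) * r + (1 / (|(R j j).re| + 1)) ^ 2 * r * (R j j).re
        = r / (|(R j j).re| + 1) ^ 2 * ((R j j).re - 2 * (|(R j j).re| + 1)) := by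
      field_simp
      ring
    rw [h2] at h1
    have h3 : 0 < r / (|(R j j).re| + 1) ^ 2 := by positivity
    have h4 := nonneg_of_mul_nonneg_right h1 h3
    linarith [le_abs_self (R j j).re, abs_nonneg (R j j).re]
  have hdiag : ∀ i, R i i = (q s i : ℂ) := by
    intro i
    have hexp : ∀ t : ℝ, sqNorm (factorAct s (Matrix.diagonal (Function.update 1 i (t : ℂ))) *ᵥ φ)
        = 1 + (t ^ 2 - 1) * (R i i).re := by
      intro t
      apply Complex.ofReal_injective
      rw [sqNorm_factorAct, ← hR]
      have e1 : (Matrix.diagonal (Function.update (1 : Fin (d s) → ℂ) i (t : ℂ)))ᴴ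
          * Matrix.diagonal (Function.update 1 i (t : ℂ))
          = 1 + Matrix.single i i ((t : ℂ) ^ 2 - 1) := by
        rw [Matrix.diagonal_conjTranspose, Matrix.diagonal_mul_diagonal]
        ext k l
        rw [Matrix.add_apply, Matrix.diagonal_apply, Matrix.one_apply, Matrix.single_apply]
        by_cases hkl : k = l
        · subst hkl
          by_cases hk : k = i
          · subst hk; simp; ring
          · have : i ≠ k := fun h => hk h.symm
            simp [hk, this]
        · have : ¬ (i = k ∧ i = l) := fun h => hkl (h.1.symm.trans h.2)
          simp [hkl, this]
      rw [e1, add_mul, Matrix.trace_add, one_mul, htr, Matrix.trace_single_mul, hreal i]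
      push_cast
      simp
    have hmin : IsLocalMin (fun t : ℝ => 1 + (t ^ 2 - 1) * (R i i).re - t ^ (2 * q s i)) 1 := by
      filter_upwards [lt_mem_nhds (zero_lt_one (α := ℝ))] with t ht
      have := h.dilation s i t ht
      rw [hexp] at this
      simpa using this
    have hd : HasDerivAt (fun t : ℝ => 1 + (t ^ 2 - 1) * (R i i).re - t ^ (2 * q s i))
        (2 * (R i i).re - 2 * q s i) 1 := by
      have h1 : HasDerivAt (fun t : ℝ => t ^ (2 * q s i)) (2 * q s i) 1 := by
        simpa using Real.hasDerivAt_rpow_const (x := 1) (p := 2 * q s i) (Or.inl one_ne_zero)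
      have h2 : HasDerivAt (fun t : ℝ => 1 + (t ^ 2 - 1) * (R i i).re) (2 * (R i i).re) 1 := by
        simpa using ((((hasDerivAt_id (1 : ℝ)).pow 2).sub_const 1).mul_const (R i i).re).const_add 1
      exact h2.sub h1
    have h0 := hmin.hasDerivAt_eq_zero hd
    rw [hreal i, Complex.ofReal_inj]
    linarith
  ext i j
  rw [Matrix.diagonal_apply]
  split_ifs with hij
  · subst hij; exact hdiag i
  · rcases lt_or_gt_of_ne hij with hlt | hlt
    · exact hoff j i hlt
    · rw [← hherm.apply i j, hoff i j hlt, star_zero]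

end firstOrder

section semiInvariant

variable {S : Type*} [Fintype S] [DecidableEq S] {d : S → ℕ}

/-- Polynomials on the space of tensors that are homogeneous of degree `N` and are semi-invariant of
weight `lam` under lower triangular matrices. -/
structure IsSemiInvariant (N : ℕ) (lam : ∀ s, Fin (d s) → ℕ)
    (P : MvPolynomial (∀ s, Fin (d s)) ℂ) : Prop where
  homogeneous : ∀ (c : ℂ) ψ, MvPolynomial.eval (c • ψ) P = c ^ N * MvPolynomial.eval ψ P
  transvection : ∀ s (i j : Fin (d s)), j < i → ∀ z ψ,
    MvPolynomial.eval (factorAct s (1 + Matrix.single i j z) *ᵥ ψ) P = MvPolynomial.eval ψ P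
  dilation : ∀ s (i : Fin (d s)) (z : ℂ) ψ,
    MvPolynomial.eval (factorAct s (Matrix.diagonal (Function.update 1 i z)) *ᵥ ψ) P
      = z ^ lam s i * MvPolynomial.eval ψ P

theorem exists_isShortest_of_isSemiInvariant {N₁ N₂ : ℕ} {lam₁ lam₂ : ∀ s, Fin (d s) → ℕ}
    {P₁ P₂ : MvPolynomial (∀ s, Fin (d s)) ℂ} (h₁ : IsSemiInvariant N₁ lam₁ P₁)
    (h₂ : IsSemiInvariant N₂ lam₂ P₂) (hP₁ : P₁ ≠ 0) (hP₂ : P₂ ≠ 0) (hN₁ : 0 < N₁)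
    (hN₂ : 0 < N₂) (p : ℝ) (hp0 : 0 ≤ p) (hp1 : p ≤ 1) :
    ∃ φ, IsShortest φ fun s i => p * (lam₁ s i / N₁) + (1 - p) * (lam₂ s i / N₂) := by
  have hN₁' : (0 : ℝ) < N₁ := Nat.cast_pos.mpr hN₁
  have hN₂' : (0 : ℝ) < N₂ := Nat.cast_pos.mpr hN₂
  have ha : 0 ≤ p / N₁ := by positivity
  have hb : 0 ≤ (1 - p) / N₂ := div_nonneg (by linarith) hN₂'.le
  let G : ((∀ s, Fin (d s)) → ℂ) → ℝ := fun ψ =>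
    ‖MvPolynomial.eval ψ P₁‖ ^ (p / N₁) * ‖MvPolynomial.eval ψ P₂‖ ^ ((1 - p) / N₂)
  have hGc : Continuous G := by
    refine Continuous.mul ?_ ?_
    · exact (MvPolynomial.continuous_eval P₁).norm.rpow_const fun _ => Or.inr ha
    · exact (MvPolynomial.continuous_eval P₂).norm.rpow_const fun _ => Or.inr hb
  have hG0 : ∀ ψ, 0 ≤ G ψ := fun ψ => by positivity
  have hGscale : ∀ (t : ℝ) (n₁ n₂ : ℕ) (ψ ψ' : (∀ s, Fin (d s)) → ℂ), 0 < t →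
      MvPolynomial.eval ψ' P₁ = (t : ℂ) ^ n₁ * MvPolynomial.eval ψ P₁ →
      MvPolynomial.eval ψ' P₂ = (t : ℂ) ^ n₂ * MvPolynomial.eval ψ P₂ →
      G ψ' = t ^ (p * (n₁ / N₁) + (1 - p) * (n₂ / N₂)) * G ψ := by
    intro t n₁ n₂ ψ ψ' ht e₁ e₂
    simp only [G]
    rw [e₁, e₂, norm_mul, norm_mul, norm_pow, norm_pow, Complex.norm_real, Real.norm_of_nonneg ht.le,
      Real.mul_rpow (by positivity) (by positivity), Real.mul_rpow (by positivity) (by positivity),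
      ← Real.rpow_natCast, ← Real.rpow_natCast, ← Real.rpow_mul ht.le, ← Real.rpow_mul ht.le,
      Real.rpow_add ht]
    rw [show (n₁ : ℝ) * (p / N₁) = p * (n₁ / N₁) by ring,
      show (n₂ : ℝ) * ((1 - p) / N₂) = (1 - p) * (n₂ / N₂) by ring]
    ring
  have hGhom : ∀ (c : ℝ) (ψ : (∀ s, Fin (d s)) → ℂ), 0 < c → G ((c : ℂ) • ψ) = c * G ψ := by
    intro c ψ hc
    rw [hGscale c N₁ N₂ ψ _ hc (h₁.homogeneous _ _) (h₂.homogeneous _ _), div_self hN₁'.ne',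
      div_self hN₂'.ne']
    simp
  have hG00 : G 0 = 0 := by
    have := hGhom 2 0 two_pos
    rw [smul_zero] at this
    linarith
  have hnormalize : ∀ ψ : (∀ s, Fin (d s)) → ℂ, ψ ≠ 0 → ∃ ψ' : (∀ s, Fin (d s)) → ℂ,
      sqNorm ψ' = 1 ∧ G ψ = √(sqNorm ψ) * G ψ' := by
    intro ψ hψ
    have hpos : 0 < sqNorm ψ :=
      lt_of_le_of_ne (sqNorm_nonneg ψ) fun h => hψ (sqNorm_eq_zero.mp h.symm)
    have hspos := Real.sqrt_pos.mpr hpos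
    refine ⟨(((√(sqNorm ψ))⁻¹ : ℝ) : ℂ) • ψ, ?_, ?_⟩
    · rw [sqNorm_smul, Complex.norm_real, Real.norm_of_nonneg (by positivity), inv_pow,
        Real.sq_sqrt hpos.le, inv_mul_cancel₀ hpos.ne']
    · rw [hGhom _ _ (by positivity), mul_inv_cancel_left₀ hspos.ne']
  obtain ⟨ψ₀, hψ₀⟩ : ∃ ψ, MvPolynomial.eval ψ (P₁ * P₂) ≠ 0 := by
    by_contra! hcon
    exact mul_ne_zero hP₁ hP₂ (MvPolynomial.funext fun x => by rw [hcon x, map_zero])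
  rw [map_mul] at hψ₀
  have hGψ₀ : 0 < G ψ₀ :=
    mul_pos (Real.rpow_pos_of_pos (norm_pos_iff.mpr (left_ne_zero_of_mul hψ₀)) _)
      (Real.rpow_pos_of_pos (norm_pos_iff.mpr (right_ne_zero_of_mul hψ₀)) _)
  have hψ₀ne : ψ₀ ≠ 0 := by
    rintro rfl
    exact hGψ₀.ne' hG00
  obtain ⟨ψ₁, hψ₁, hGψ₁⟩ := hnormalize ψ₀ hψ₀ne
  obtain ⟨φ, hφ, hmax⟩ := isCompact_sqNorm_eq_one.exists_isMaxOn ⟨ψ₁, hψ₁⟩ hGc.continuousOn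
  have hφ1 : sqNorm φ = 1 := hφ
  have hGφ : 0 < G φ := by
    have h1 : G ψ₁ ≤ G φ := hmax hψ₁
    have h2 : 0 < G ψ₁ := by
      refine lt_of_le_of_ne (hG0 _) fun h => ?_
      rw [← h, mul_zero] at hGψ₁
      exact hGψ₀.ne' hGψ₁
    linarith
  have hbound : ∀ ψ, G ψ ≤ √(sqNorm ψ) * G φ := by
    intro ψ
    by_cases hψ : ψ = 0
    · rw [hψ, hG00]; positivity
    · obtain ⟨ψ', hψ', he⟩ := hnormalize ψ hψ
      rw [he]
      exact mul_le_mul_of_nonneg_left (hmax hψ') (Real.sqrt_nonneg _)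
  refine ⟨φ, hφ1, ?_, ?_⟩
  · intro s i j hji z
    have h1 := hbound (factorAct s (1 + Matrix.single i j z) *ᵥ φ)
    have h2 : G (factorAct s (1 + Matrix.single i j z) *ᵥ φ) = G φ := by
      simp only [G]
      rw [h₁.transvection s i j hji, h₂.transvection s i j hji]
    rw [h2] at h1
    have h3 : 1 ≤ √(sqNorm (factorAct s (1 + Matrix.single i j z) *ᵥ φ)) := by
      by_contra! hcon
      nlinarith
    exact Real.one_le_sqrt.mp h3
  · intro s i t ht
    have h1 := hbound (factorAct s (Matrix.diagonal (Function.update 1 i (t : ℂ))) *ᵥ φ)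
    rw [hGscale t _ _ φ _ ht (h₁.dilation s i _ _) (h₂.dilation s i _ _)] at h1
    have h3 := le_of_mul_le_mul_right h1 hGφ
    rw [Real.le_sqrt (by positivity) (sqNorm_nonneg _), ← Real.rpow_natCast,
      ← Real.rpow_mul ht.le] at h3
    rw [mul_comm (2 : ℝ)]
    exact_mod_cast h3

end semiInvariant

section wordPolynomial

variable {X : Type*} [Fintype X]

/-- The homogeneous polynomial `ψ ↦ ⟪h, ψ ^ ⊗ N⟫` attached to a vector `h` of the `N`-th tensor
power. -/
def wordPolynomial {N : ℕ} (h : (Fin N → X) → ℂ) : MvPolynomial X ℂ :=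
  open Classical in ∑ x, MvPolynomial.C (star (h x)) * ∏ n, MvPolynomial.X (x n)

theorem eval_wordPolynomial {N : ℕ} (h : (Fin N → X) → ℂ) (ψ : X → ℂ) :
    MvPolynomial.eval ψ (wordPolynomial h) = star h ⬝ᵥ tensorPow N ψ := by
  classical
  simp only [wordPolynomial, map_sum, map_mul, MvPolynomial.eval_C, map_prod,
    MvPolynomial.eval_X, dotProduct, tensorPow, Pi.star_apply]

omit [Fintype X] in
theorem tensorPow_smul {N : ℕ} (c : ℂ) (ψ : X → ℂ) :
    tensorPow N (c • ψ) = c ^ N • tensorPow N ψ := by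
  ext x
  simp [tensorPow, Finset.prod_mul_distrib]

theorem sqNorm_tensorPow (N : ℕ) (ψ : X → ℂ) : sqNorm (tensorPow N ψ) = sqNorm ψ ^ N := by
  apply Complex.ofReal_injective
  rw [Complex.ofReal_pow, ofReal_sqNorm, ofReal_sqNorm, star_tensorPow_dotProduct]

theorem sqNorm_eq_norm_sq (ψ : X → ℂ) : sqNorm ψ = ‖WithLp.toLp 2 ψ‖ ^ 2 := by
  rw [EuclideanSpace.norm_sq_eq]; rfl

theorem inner_toLp_eq (φ ψ : X → ℂ) :
    inner ℂ (WithLp.toLp 2 φ) (WithLp.toLp 2 ψ) = star φ ⬝ᵥ ψ := by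
  rw [EuclideanSpace.inner_eq_star_dotProduct, dotProduct_comm]

theorem norm_sq_eval_wordPolynomial_le {N : ℕ} (h : (Fin N → X) → ℂ) (ψ : X → ℂ) :
    ‖MvPolynomial.eval ψ (wordPolynomial h)‖ ^ 2 ≤ sqNorm h * sqNorm ψ ^ N := by
  classical
  rw [eval_wordPolynomial, ← sqNorm_tensorPow, sqNorm_eq_norm_sq, sqNorm_eq_norm_sq,
    ← inner_toLp_eq, ← mul_pow]
  exact pow_le_pow_left₀ (norm_nonneg _) (norm_inner_le_norm _ _) 2

end wordPolynomial

section highestWeight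

variable {S : Type*} [Fintype S] [DecidableEq S] {d : S → ℕ}

/-- Highest weight vectors of weight `lam` in the `N`-th tensor power. -/
structure IsHighestWeight {N : ℕ} (lam : ∀ s, Fin (d s) → ℕ)
    (h : (Fin N → ∀ t, Fin (d t)) → ℂ) : Prop where
  antitone : ∀ s, Antitone (lam s)
  sum_eq : ∀ s, ∑ i, lam s i = N
  weight : ∀ x, h x ≠ 0 → ∀ s i, letterCount s i x = lam s i
  transvection : ∀ s (i j : Fin (d s)), j < i → ∀ z, powAct N s (1 + Matrix.single j i z) *ᵥ h = h

theorem powAct_conjTranspose (N : ℕ) (s : S) (A : Matrix (Fin (d s)) (Fin (d s)) ℂ) :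
    (powAct (d := d) N s A)ᴴ = powAct N s Aᴴ := by
  rw [powAct, powAct, piKron_conjTranspose, factorAct_conjTranspose]

theorem eval_factorAct_wordPolynomial {N : ℕ} (h : (Fin N → ∀ t, Fin (d t)) → ℂ) (s : S)
    (A : Matrix (Fin (d s)) (Fin (d s)) ℂ) (ψ : (∀ t, Fin (d t)) → ℂ) :
    MvPolynomial.eval (factorAct s A *ᵥ ψ) (wordPolynomial h)
      = MvPolynomial.eval ψ (wordPolynomial (powAct N s Aᴴ *ᵥ h)) := by
  rw [eval_wordPolynomial, eval_wordPolynomial, ← piKron_mulVec_tensorPow, ← powAct,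
    Matrix.star_mulVec, ← Matrix.dotProduct_mulVec, powAct_conjTranspose, conjTranspose_conjTranspose]

theorem IsHighestWeight.isSemiInvariant {N : ℕ} {lam : ∀ s, Fin (d s) → ℕ}
    {h : (Fin N → ∀ t, Fin (d t)) → ℂ} (hh : IsHighestWeight lam h) :
    IsSemiInvariant N lam (wordPolynomial h) where
  homogeneous c ψ := by
    rw [eval_wordPolynomial, eval_wordPolynomial, tensorPow_smul, dotProduct_smul, smul_eq_mul]
  transvection s i j hji z ψ := by
    rw [eval_factorAct_wordPolynomial, conjTranspose_add, conjTranspose_one,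
      conjTranspose_single, hh.transvection s i j hji]
  dilation s i z ψ := by
    rw [eval_factorAct_wordPolynomial, diagonal_conjTranspose, powAct_diagonal_mulVec,
      eval_wordPolynomial, eval_wordPolynomial]
    have : star (Function.update (1 : Fin (d s) → ℂ) i z) = Function.update (1 : Fin (d s) → ℂ) i (star z) := by
      ext j
      by_cases hj : j = i
      · subst hj; simp
      · simp [hj]
    rw [this, dotProduct, dotProduct, Finset.mul_sum]
    refine Finset.sum_congr rfl fun x _ => ?_
    by_cases hx : h x = 0
    · simp [hx]
    · simp only [Pi.star_apply, Pi.mul_apply, prod_update_one, hh.weight x hx s i, star_mul',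
        star_pow, star_star]
      ring

theorem finrank_span_tensorPow_le {X : Type*} [Fintype X] (N : ℕ) :
    Module.finrank ℂ (Submodule.span ℂ (Set.range fun ψ : X → ℂ => tensorPow N ψ))
      ≤ (N + 1) ^ Fintype.card X := by
  classical
  let count : (Fin N → X) → (X → Fin (N + 1)) := fun x y =>
    ⟨(Finset.univ.filter fun n => x n = y).card,
      Nat.lt_succ_of_le ((Finset.card_filter_le _ _).trans_eq (by simp))⟩
  have hle : Submodule.span ℂ (Set.range fun ψ : X → ℂ => tensorPow N ψ)
      ≤ LinearMap.range (LinearMap.funLeft ℂ ℂ count) := by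
    rw [Submodule.span_le]
    rintro _ ⟨ψ, rfl⟩
    refine ⟨fun m => ∏ y, ψ y ^ (m y : ℕ), ?_⟩
    ext x
    simp only [LinearMap.funLeft_apply, count, tensorPow]
    rw [← Finset.prod_fiberwise (s := Finset.univ) (g := x)]
    refine Finset.prod_congr rfl fun y _ => ?_
    rw [Finset.prod_congr rfl fun n hn => by rw [(Finset.mem_filter.mp hn).2], Finset.prod_const]
  refine (Submodule.finrank_mono hle).trans ((LinearMap.finrank_range_le _).trans_eq ?_)
  simp

theorem exists_large_highestWeight (φ : (∀ s, Fin (d s)) → ℂ) (hφ : sqNorm φ = 1) (N : ℕ) :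
    ∃ k : ∀ s, Matrix (Fin (d s)) (Fin (d s)) ℂ, (∀ s, k s ∈ Matrix.unitaryGroup (Fin (d s)) ℂ) ∧
      ∃ (lam : ∀ s, Fin (d s) → ℕ) (h : (Fin N → ∀ t, Fin (d t)) → ℂ), IsHighestWeight lam h ∧
        sqNorm h = 1 ∧
        1 ≤ 2 * ((N : ℝ) + 1) ^ Fintype.card (∀ s, Fin (d s)) *
          ‖MvPolynomial.eval (piKron k *ᵥ φ) (wordPolynomial h)‖ ^ 2 := by
  classical
  have (s : S) : CompactSpace (Matrix.unitaryGroup (Fin (d s)) ℂ) := compactSpace_unitaryGroup _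
  let g : (∀ s, Matrix.unitaryGroup (Fin (d s)) ℂ) →
      Matrix (Fin N → ∀ s, Fin (d s)) (Fin N → ∀ s, Fin (d s)) ℂ := fun k =>
     piKron fun _ : Fin N => piKron fun s => (k s : Matrix _ _ ℂ)
  let ρ : (∀ s, Matrix.unitaryGroup (Fin (d s)) ℂ) →*
      (EuclideanSpace ℂ (Fin N → ∀ s, Fin (d s)) →L[ℂ] EuclideanSpace ℂ (Fin N → ∀ s, Fin (d s))) :=
    { toFun := fun k => Matrix.toEuclideanCLM (𝕜 := ℂ) (g k)
      map_one' := by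
        rw [show g 1 = 1 by simp [g, piKron_one], map_one]
      map_mul' := fun k l => by
        rw [← map_mul]; simp [g, piKron_mul] }
  have hρapply : ∀ k (u : (Fin N → ∀ s, Fin (d s)) → ℂ), ρ k (WithLp.toLp 2 u) = WithLp.toLp 2 (g k *ᵥ u) := fun k u => rfl
  have hg : ∀ k, (g k)ᴴ * g k = 1 := by
    intro k
    have h1 : ∀ s, (k s : Matrix (Fin (d s)) (Fin (d s)) ℂ)ᴴ * (k s : Matrix _ _ ℂ) = 1 := fun s =>
      Matrix.mem_unitaryGroup_iff'.mp (k s).2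
    simp [g, piKron_conjTranspose, piKron_mul, h1, piKron_one]
  have hρ : Continuous ρ := by
    have h1 : Continuous g := by
      refine continuous_piKron _ (continuous_pi fun _ => continuous_piKron _ ?_)
      fun_prop
    have h2 : Continuous (Matrix.toEuclideanCLM (n := Fin N → ∀ s, Fin (d s)) (𝕜 := ℂ)) :=
      LinearMap.continuous_of_finiteDimensional
        (Matrix.toEuclideanCLM (n := Fin N → ∀ s, Fin (d s)) (𝕜 := ℂ)).toAlgEquiv.toLinearMap
    exact h2.comp h1
  have hiso : ∀ k v w, inner ℂ (ρ k v) (ρ k w) = inner ℂ v w := by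
    intro k v w
    obtain ⟨v, rfl⟩ := (WithLp.equiv 2 _).symm.surjective v
    obtain ⟨w, rfl⟩ := (WithLp.equiv 2 _).symm.surjective w
    simp only [WithLp.equiv_symm_apply, hρapply, inner_toLp_eq]
    rw [Matrix.star_mulVec, ← Matrix.dotProduct_mulVec, Matrix.mulVec_mulVec, hg, Matrix.one_mulVec]
  let P : EuclideanSpace ℂ (Fin N → ∀ s, Fin (d s)) → Prop := fun h => ∃ lam, IsHighestWeight lam (WithLp.ofLp h)
  let e := (WithLp.linearEquiv 2 ℂ ((Fin N → ∀ s, Fin (d s)) → ℂ))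
  have hP : ∀ V : Submodule ℂ (EuclideanSpace ℂ (Fin N → ∀ s, Fin (d s))), V ≠ ⊥ → (∀ k, ∀ u ∈ V, ρ k u ∈ V) →
      ∃ h ∈ V, ‖h‖ = 1 ∧ P h := by
    intro V hV hinv
    obtain ⟨h, hhV, h0, lam, h1, h2, h3, h4⟩ :=
      exists_highestWeight_vector (d := d) (N := N) (U := V.map e.toLinearMap) (by
        rintro s A hA _ ⟨u, hu, rfl⟩
        refine ⟨ρ (Function.update 1 s ⟨A, hA⟩) u, hinv _ u hu, ?_⟩
        obtain ⟨u, rfl⟩ := (WithLp.equiv 2 _).symm.surjective u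
        have : (fun t => ((Function.update (1 : (∀ s, Matrix.unitaryGroup (Fin (d s)) ℂ)) s ⟨A, hA⟩ t : Matrix.unitaryGroup _ ℂ) :
            Matrix (Fin (d t)) (Fin (d t)) ℂ)) = Function.update (fun _ => 1) s A := by
          ext1 t
          by_cases ht : t = s
          · subst ht; simp
          · simp [ht]
        simp only [WithLp.equiv_symm_apply, hρapply, g, this]
        rfl) (by
        intro hbot
        exact hV ((Submodule.map_eq_bot_iff (e := e)).mp hbot))
    obtain ⟨v, hv, rfl⟩ := hhV
    have hv0 : v ≠ 0 := by rintro rfl; simp at h0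
    have hn : ‖v‖ ≠ 0 := norm_ne_zero_iff.mpr hv0
    refine ⟨((‖v‖⁻¹ : ℝ) : ℂ) • v, V.smul_mem _ hv, ?_, lam, h1, h2, ?_, ?_⟩
    · rw [norm_smul, Complex.norm_real, norm_inv, norm_norm, inv_mul_cancel₀ hn]
    · intro x hx
      refine h3 x fun h => hx ?_
      have h' : v.ofLp x = 0 := h
      simp [h']
    · intro s i j hji z
      rw [WithLp.ofLp_smul, Matrix.mulVec_smul]
      congr 1
      exact h4 s i j hji z
  let U' := Submodule.span ℂ (Set.range fun ψ : (∀ s, Fin (d s)) → ℂ => tensorPow N ψ)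
  let U : Submodule ℂ (EuclideanSpace ℂ (Fin N → ∀ s, Fin (d s))) := U'.map e.symm.toLinearMap
  have hUinv : ∀ k, ∀ u ∈ U, ρ k u ∈ U := by
    rintro k _ ⟨u, hu, rfl⟩
    refine ⟨g k *ᵥ u, ?_, rfl⟩
    refine Submodule.span_induction (p := fun u _ => g k *ᵥ u ∈ U') ?_ ?_ ?_ ?_ hu
    · rintro _ ⟨ψ, rfl⟩
      simp only [g, piKron_mulVec_tensorPow]
      exact Submodule.subset_span ⟨_, rfl⟩
    · simp
    · intro x y _ _ hx hy
      rw [Matrix.mulVec_add]; exact add_mem hx hy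
    · intro c x _ hx
      rw [Matrix.mulVec_smul]; exact U'.smul_mem _ hx
  have hwU : WithLp.toLp 2 (tensorPow N φ) ∈ U := ⟨_, Submodule.subset_span ⟨φ, rfl⟩, rfl⟩
  have hw1 : ‖WithLp.toLp 2 (tensorPow N φ)‖ ^ 2 = 1 := by
    rw [← sqNorm_eq_norm_sq, sqNorm_tensorPow, hφ, one_pow]
  have hfin : (Module.finrank ℂ U : ℝ) ≤ ((N : ℝ) + 1) ^ Fintype.card (∀ s, Fin (d s)) := by
    rw [show Module.finrank ℂ U = Module.finrank ℂ U' from LinearEquiv.finrank_map_eq e.symm U']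
    exact_mod_cast finrank_span_tensorPow_le N
  by_contra! hcon
  set D := ((N : ℝ) + 1) ^ Fintype.card (∀ s, Fin (d s)) with hD
  have hDpos : 0 < D := by positivity
  have := norm_starProjection_sq_le ρ hρ hiso P hP (WithLp.toLp 2 (tensorPow N φ)) (1 / (2 * D)) U
    hUinv (by
      rintro h hhU hh1 ⟨lam, hlam⟩ k
      have h1 := hcon (fun s => (k s : Matrix _ _ ℂ)ᴴ) (fun s => by
        rw [← star_eq_conjTranspose]; exact Unitary.star_mem (k s).2) lam h.ofLp hlam (by
          rw [sqNorm_eq_norm_sq, WithLp.toLp_ofLp, hh1, one_pow])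
      have h2 : inner ℂ (ρ k h) (WithLp.toLp 2 (tensorPow N φ))
          = MvPolynomial.eval (piKron (fun s => (k s : Matrix (Fin (d s)) (Fin (d s)) ℂ)ᴴ) *ᵥ φ)
            (wordPolynomial h.ofLp) := by
        obtain ⟨h, rfl⟩ := (WithLp.equiv 2 _).symm.surjective h
        simp only [WithLp.equiv_symm_apply, hρapply, inner_toLp_eq]
        rw [Matrix.star_mulVec, ← Matrix.dotProduct_mulVec, eval_wordPolynomial,
          ← piKron_mulVec_tensorPow, ← piKron_conjTranspose]
        simp only [g, piKron_conjTranspose]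
      rw [h2, le_div_iff₀ (by positivity)]
      linarith)
  rw [Submodule.starProjection_eq_self_iff.mpr hwU, hw1] at this
  have h2 : (Module.finrank ℂ U : ℝ) * (1 / (2 * D)) ≤ D * (1 / (2 * D)) :=
    mul_le_mul_of_nonneg_right hfin (by positivity)
  have h3 : D * (1 / (2 * D)) = 1 / 2 := by field_simp
  linarith

end highestWeight

section spectralVector

open Polynomial

theorem exists_perm_of_map_univ_eq {I α : Type*} [Fintype I] {p q : I → α}
    (h : Finset.univ.val.map p = Finset.univ.val.map q) : ∃ σ : Equiv.Perm I, p = q ∘ σ := by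
  classical
  have hcard : ∀ y, Fintype.card {i // p i = y} = Fintype.card {i // q i = y} := by
    intro y
    have := congrArg (Multiset.count y) h
    rw [Multiset.count_map, Multiset.count_map] at this
    rw [Fintype.card_subtype, Fintype.card_subtype]
    simp only [eq_comm (a := y)] at this
    exact this
  refine ⟨(Equiv.sigmaFiberEquiv p).symm.trans ((Equiv.sigmaCongrRight fun y =>
    Fintype.equivOfCardEq (hcard y)).trans (Equiv.sigmaFiberEquiv q)), funext fun i => ?_⟩
  exact (Fintype.equivOfCardEq (hcard (p i)) ⟨i, rfl⟩).2.symm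

theorem exists_perm_of_prod_X_sub_C_eq {I : Type*} [Fintype I] {p q : I → ℝ}
    (h : ∏ i, (X - C (p i : ℂ)) = ∏ i, (X - C (q i : ℂ))) :
    ∃ σ : Equiv.Perm I, p = q ∘ σ := by
  have hroots : ∀ f : I → ℝ, (∏ i, (X - C (f i : ℂ))).roots
      = (Finset.univ.val.map f).map Complex.ofReal := by
    intro f
    rw [Polynomial.roots_prod _ _ (by simp [Finset.prod_ne_zero_iff, X_sub_C_ne_zero])]
    simp
  have h1 := congrArg Polynomial.roots h
  rw [hroots, hroots] at h1
  exact exists_perm_of_map_univ_eq (Multiset.map_injective Complex.ofReal_injective h1)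

theorem eq_of_antitone_of_prod_X_sub_C_eq {n : ℕ} {p q : Fin n → ℝ} (hp : Antitone p)
    (hq : Antitone q) (h : ∏ i, (X - C (p i : ℂ)) = ∏ i, (X - C (q i : ℂ))) : p = q := by
  obtain ⟨σ, hσ⟩ := exists_perm_of_prod_X_sub_C_eq h
  rw [hσ] at hp ⊢
  exact Tuple.unique_antitone (τ := Equiv.refl _) hp hq

theorem charpoly_unitary_conj {n : Type*} [Fintype n] [DecidableEq n] {k A : Matrix n n ℂ}
    (hk : k ∈ Matrix.unitaryGroup n ℂ) : (k * A * kᴴ).charpoly = A.charpoly := by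
  rw [Matrix.charpoly_mul_comm, ← Matrix.mul_assoc, ← star_eq_conjTranspose,
    Matrix.mem_unitaryGroup_iff'.mp hk, Matrix.one_mul]

end spectralVector

open Filter Topology in
theorem tendsto_two_mul_pow_rpow_inv (c : ℕ) :
    Tendsto (fun N : ℕ => (2 * ((N : ℝ) + 1) ^ c) ^ ((N : ℝ)⁻¹)) atTop (𝓝 1) := by
  have h1 : Tendsto (fun N : ℕ => (2 : ℝ) ^ ((N : ℝ)⁻¹)) atTop (𝓝 1) := by
    have := (Real.continuous_const_rpow (a := 2) two_ne_zero).tendsto 0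
    rw [Real.rpow_zero] at this
    exact this.comp tendsto_inv_atTop_nhds_zero_nat
  have h2 : Tendsto (fun N : ℕ => (((N : ℝ) + 1) ^ c) ^ ((N : ℝ)⁻¹)) atTop (𝓝 1) := by
    have h3 := tendsto_rpow_div_mul_add (c : ℝ) 1 (-1) zero_ne_one
    have h4 : Tendsto (fun N : ℕ => (N : ℝ) + 1) atTop atTop :=
      tendsto_atTop_add_const_right _ _ tendsto_natCast_atTop_atTop
    refine (h3.comp h4).congr fun N => ?_
    simp only [Function.comp]
    rw [← Real.rpow_natCast, ← Real.rpow_mul (by positivity), div_eq_mul_inv]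
    congr 3
    ring
  have := h1.mul h2
  rw [one_mul] at this
  refine this.congr fun N => ?_
  rw [Real.mul_rpow two_pos.le (by positivity)]

section limit

variable {S : Type*} [Fintype S] [DecidableEq S] {d : S → ℕ}

theorem sqNorm_piKron_mulVec {φ : (∀ s, Fin (d s)) → ℂ}
    {k : ∀ s, Matrix (Fin (d s)) (Fin (d s)) ℂ}
    (hk : ∀ s, k s ∈ Matrix.unitaryGroup (Fin (d s)) ℂ) :
    sqNorm (piKron k *ᵥ φ) = sqNorm φ := by
  have h1 : ∀ s, (k s)ᴴ * k s = 1 := fun s => Matrix.mem_unitaryGroup_iff'.mp (hk s)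
  apply Complex.ofReal_injective
  rw [ofReal_sqNorm, ofReal_sqNorm, Matrix.star_mulVec, ← Matrix.dotProduct_mulVec,
    Matrix.mulVec_mulVec, piKron_conjTranspose, piKron_mul]
  simp only [h1]
  rw [piKron_one, Matrix.one_mulVec]

theorem rpow_le_mul_sqNorm {N : ℕ} (hN : 0 < N) {D : ℝ} (hD : 0 < D) {l : ℕ} {t : ℝ} (ht : 0 < t)
    {h : (Fin N → ∀ s, Fin (d s)) → ℂ} (hh : sqNorm h = 1) {ψ ψ' : (∀ s, Fin (d s)) → ℂ}
    (hψ : 1 ≤ D * ‖MvPolynomial.eval ψ (wordPolynomial h)‖ ^ 2)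
    (hψ' : MvPolynomial.eval ψ' (wordPolynomial h)
      = (t : ℂ) ^ l * MvPolynomial.eval ψ (wordPolynomial h)) :
    t ^ (2 * ((l : ℝ) / N)) ≤ D ^ ((N : ℝ)⁻¹) * sqNorm ψ' := by
  have hN' : (0 : ℝ) < N := Nat.cast_pos.mpr hN
  have h1 := norm_sq_eval_wordPolynomial_le h ψ'
  rw [hh, one_mul, hψ', norm_mul, norm_pow, Complex.norm_real, Real.norm_of_nonneg ht.le,
    mul_pow] at h1
  have h2 : (t ^ l) ^ 2 ≤ D * sqNorm ψ' ^ N := by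
    calc (t ^ l) ^ 2 ≤ (t ^ l) ^ 2 * (D * ‖MvPolynomial.eval ψ (wordPolynomial h)‖ ^ 2) :=
          le_mul_of_one_le_right (by positivity) hψ
      _ = D * ((t ^ l) ^ 2 * ‖MvPolynomial.eval ψ (wordPolynomial h)‖ ^ 2) := by ring
      _ ≤ _ := mul_le_mul_of_nonneg_left h1 hD.le
  have h3 := Real.rpow_le_rpow (by positivity) h2 (inv_nonneg.mpr hN'.le)
  rw [Real.mul_rpow hD.le (pow_nonneg (sqNorm_nonneg _) _),
    Real.pow_rpow_inv_natCast (sqNorm_nonneg _) hN.ne', ← pow_mul, ← Real.rpow_natCast,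
    ← Real.rpow_mul ht.le] at h3
  convert h3 using 2
  push_cast
  field_simp

open Filter Topology in
theorem exists_isShortest_limit (φ : (∀ s, Fin (d s)) → ℂ) (hφ : sqNorm φ = 1) :
    ∃ k : ∀ s, Matrix (Fin (d s)) (Fin (d s)) ℂ, (∀ s, k s ∈ Matrix.unitaryGroup (Fin (d s)) ℂ) ∧
      ∃ q : ∀ s, Fin (d s) → ℝ, (∀ s, Antitone (q s)) ∧ IsShortest (piKron k *ᵥ φ) q ∧
        ∃ (N : ℕ → ℕ) (lam : ℕ → ∀ s, Fin (d s) → ℕ)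
          (P : ℕ → MvPolynomial (∀ s, Fin (d s)) ℂ),
          (∀ n, 0 < N n) ∧ (∀ n, P n ≠ 0) ∧ (∀ n, IsSemiInvariant (N n) (lam n) (P n)) ∧
          ∀ s i, Tendsto (fun n => (lam n s i : ℝ) / N n) atTop (𝓝 (q s i)) := by
  choose k hk lam h hh hh1 hlarge using fun n : ℕ => exists_large_highestWeight φ hφ (n + 1)
  have hlam : ∀ n s i, lam n s i ≤ n + 1 := by
    intro n s i
    rw [← (hh n).sum_eq s]
    exact Finset.single_le_sum (fun _ _ => Nat.zero_le _) (Finset.mem_univ i)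
  let r : ℕ → ∀ s, Fin (d s) → ℝ := fun n s i => (lam n s i : ℝ) / ((n + 1 : ℕ) : ℝ)
  have (s : S) : CompactSpace (Matrix.unitaryGroup (Fin (d s)) ℂ) := compactSpace_unitaryGroup _
  have hcomp : IsCompact ((Set.univ.pi fun s =>
      (Matrix.unitaryGroup (Fin (d s)) ℂ : Set (Matrix (Fin (d s)) (Fin (d s)) ℂ))) ×ˢ
      (Set.univ.pi fun s => Set.univ.pi fun _ : Fin (d s) => Set.Icc (0 : ℝ) 1)) :=
    (isCompact_univ_pi fun s => isCompact_iff_compactSpace.mpr (this s)).prod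
      (isCompact_univ_pi fun s => isCompact_univ_pi fun _ => isCompact_Icc)
  have (s : S) : FirstCountableTopology (Matrix (Fin (d s)) (Fin (d s)) ℂ) :=
    inferInstanceAs (FirstCountableTopology (Fin (d s) → Fin (d s) → ℂ))
  obtain ⟨⟨k₀, q⟩, ⟨hk₀, -⟩, σ, hσ, hlim⟩ := hcomp.tendsto_subseq (x := fun n => (k n, r n)) (by
    intro n
    refine ⟨fun s _ => hk n s, fun s _ i _ => ⟨by positivity, ?_⟩⟩
    exact div_le_one_of_le₀ (by exact_mod_cast hlam n s i) (by positivity))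
  have hlimk : Tendsto (fun n => piKron (k (σ n)) *ᵥ φ) atTop (𝓝 (piKron k₀ *ᵥ φ)) := by
    have h1 : Continuous fun k : ∀ s, Matrix (Fin (d s)) (Fin (d s)) ℂ => piKron k *ᵥ φ :=
      (continuous_piKron _ continuous_id).matrix_mulVec continuous_const
    exact (h1.tendsto k₀).comp ((continuous_fst.tendsto _).comp hlim)
  have hlimq : ∀ s i, Tendsto (fun n => r (σ n) s i) atTop (𝓝 (q s i)) := by
    intro s i
    have h1 : Continuous fun x : (∀ s, Matrix (Fin (d s)) (Fin (d s)) ℂ) × (∀ s, Fin (d s) → ℝ) =>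
      x.2 s i := by fun_prop
    exact (h1.tendsto _).comp hlim
  have hlimD := ((tendsto_two_mul_pow_rpow_inv (Fintype.card (∀ s, Fin (d s)))).comp
    (tendsto_add_atTop_nat 1)).comp hσ.tendsto_atTop
  have hlimA : ∀ A : Matrix (∀ s, Fin (d s)) (∀ s, Fin (d s)) ℂ,
      Tendsto (fun n => (2 * ((((σ n + 1 : ℕ)) : ℝ) + 1) ^ Fintype.card (∀ s, Fin (d s))) ^
        (((σ n + 1 : ℕ) : ℝ)⁻¹) * sqNorm (A *ᵥ (piKron (k (σ n)) *ᵥ φ))) atTop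
        (𝓝 (sqNorm (A *ᵥ (piKron k₀ *ᵥ φ)))) := by
    intro A
    have h1 : Continuous fun ψ : (∀ s, Fin (d s)) → ℂ => sqNorm (A *ᵥ ψ) :=
      continuous_sqNorm.comp (continuous_const.matrix_mulVec continuous_id)
    have := hlimD.mul ((h1.tendsto _).comp hlimk)
    rw [one_mul] at this
    exact this
  refine ⟨k₀, fun s => hk₀ s trivial, q, ?_, ⟨?_, ?_, ?_⟩, fun n => σ n + 1, fun n => lam (σ n),
    fun n => wordPolynomial (h (σ n)), fun n => Nat.succ_pos _, ?_,
    fun n => (hh (σ n)).isSemiInvariant, hlimq⟩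
  · intro s i j hij
    refine le_of_tendsto_of_tendsto' (hlimq s j) (hlimq s i) fun n => ?_
    have := (hh (σ n)).antitone s hij
    exact div_le_div_of_nonneg_right (by exact_mod_cast this) (by positivity)
  · rw [sqNorm_piKron_mulVec fun s => hk₀ s trivial, hφ]
  · intro s i j hji z
    refine ge_of_tendsto' (hlimA _) fun n => ?_
    have := rpow_le_mul_sqNorm (Nat.succ_pos (σ n)) (by positivity) one_pos (l := 0) (hh1 (σ n))
      (hlarge (σ n))
      (ψ' := factorAct s (1 + Matrix.single i j z) *ᵥ (piKron (k (σ n)) *ᵥ φ)) (by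
        rw [(hh (σ n)).isSemiInvariant.transvection s i j hji]; simp)
    rw [Real.one_rpow] at this
    exact this
  · intro s i t ht
    have h1 : Tendsto (fun n => t ^ (2 * r (σ n) s i)) atTop (𝓝 (t ^ (2 * q s i))) :=
      ((Real.continuous_const_rpow ht.ne').tendsto _).comp ((hlimq s i).const_mul 2)
    refine le_of_tendsto_of_tendsto' h1 (hlimA _) fun n => ?_
    exact rpow_le_mul_sqNorm (Nat.succ_pos (σ n)) (by positivity) ht (hh1 (σ n))
      (hlarge (σ n))
      ((hh (σ n)).isSemiInvariant.dilation s i _ _)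
  · intro n (hzero : wordPolynomial (h (σ n)) = 0)
    have := hlarge (σ n)
    rw [hzero, map_zero] at this
    norm_num at this

open Filter Topology Polynomial in
theorem exists_isSemiInvariant_tendsto (φ : (∀ s, Fin (d s)) → ℂ) (hφ : sqNorm φ = 1)
    {p : ∀ s, Fin (d s) → ℝ} (hp : ∀ s, Antitone (p s))
    (hφp : ∀ s, (marginal φ s).charpoly = ∏ i, (X - C (p s i : ℂ))) :
    ∃ (N : ℕ → ℕ) (lam : ℕ → ∀ s, Fin (d s) → ℕ) (P : ℕ → MvPolynomial (∀ s, Fin (d s)) ℂ),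
      (∀ n, 0 < N n) ∧ (∀ n, P n ≠ 0) ∧ (∀ n, IsSemiInvariant (N n) (lam n) (P n)) ∧
      ∀ s i, Tendsto (fun n => (lam n s i : ℝ) / N n) atTop (𝓝 (p s i)) := by
  obtain ⟨k, hk, q, hq, hshort, N, lam, P, h1, h2, h3, h4⟩ := exists_isShortest_limit φ hφ
  have hqp : q = p := by
    ext1 s
    refine eq_of_antitone_of_prod_X_sub_C_eq (hq s) (hp s) ?_
    rw [← hφp s, ← charpoly_unitary_conj (hk s), ← marginal_piKron_mulVec φ k hk,
      hshort.marginal_eq, Matrix.charpoly_diagonal]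
  exact ⟨N, lam, P, h1, h2, h3, hqp ▸ h4⟩

open Filter Topology Polynomial in
theorem exists_marginal_eq_convex_combination (φ φ' : (∀ s, Fin (d s)) → ℂ) (hφ : sqNorm φ = 1)
    (hφ' : sqNorm φ' = 1) {p p' : ∀ s, Fin (d s) → ℝ} (hp : ∀ s, Antitone (p s))
    (hp' : ∀ s, Antitone (p' s))
    (hφp : ∀ s, (marginal φ s).charpoly = ∏ i, (X - C (p s i : ℂ)))
    (hφp' : ∀ s, (marginal φ' s).charpoly = ∏ i, (X - C (p' s i : ℂ)))
    (t : ℝ) (ht0 : 0 ≤ t) (ht1 : t ≤ 1) :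
    ∃ ψ : (∀ s, Fin (d s)) → ℂ, sqNorm ψ = 1 ∧ ∀ s, marginal ψ s
      = Matrix.diagonal fun i => ((t * p s i + (1 - t) * p' s i : ℝ) : ℂ) := by
  obtain ⟨N, lam, P, h1, h2, h3, h4⟩ := exists_isSemiInvariant_tendsto φ hφ hp hφp
  obtain ⟨N', lam', P', h1', h2', h3', h4'⟩ := exists_isSemiInvariant_tendsto φ' hφ' hp' hφp'
  choose ψ hψ using fun n => exists_isShortest_of_isSemiInvariant (h3 n) (h3' n) (h2 n) (h2' n)
    (h1 n) (h1' n) t ht0 ht1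
  obtain ⟨ψ₀, hψ₀, σ, hσ, hlim⟩ := isCompact_sqNorm_eq_one.tendsto_subseq
    fun n => (hψ n).sqNorm_eq
  refine ⟨ψ₀, hψ₀, fun s => ?_⟩
  refine tendsto_nhds_unique (((continuous_marginal s).tendsto ψ₀).comp hlim) ?_
  have hd : Tendsto (fun n => Matrix.diagonal fun i : Fin (d s) =>
      ((t * ((lam (σ n) s i : ℝ) / N (σ n)) + (1 - t) * ((lam' (σ n) s i : ℝ) / N' (σ n)) : ℝ) : ℂ))
      atTop (𝓝 (Matrix.diagonal fun i => ((t * p s i + (1 - t) * p' s i : ℝ) : ℂ))) := by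
    refine (Continuous.matrix_diagonal continuous_id).tendsto _ |>.comp
      (tendsto_pi_nhds.mpr fun i => ?_)
    refine (Complex.continuous_ofReal.tendsto _).comp ?_
    exact (((h4 s i).comp hσ.tendsto_atTop).const_mul t).add
      (((h4' s i).comp hσ.tendsto_atTop).const_mul (1 - t))
  exact hd.congr fun n => ((hψ (σ n)).marginal_eq s).symm

end limit

section bridge

open Polynomial

theorem isSpectrum_iff {d : ℕ} {I : Type*} [Fintype I] [DecidableEq I]
    (A : Matrix I I ℂ) (e : I ≃ Fin d) (a : I → ℝ) :
    IsSpectrum A e a ↔ A.IsHermitian ∧ A.charpoly = ∏ i, (X - C (a i : ℂ)) ∧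
      Antitone (a ∘ e.symm) := by
  constructor
  · rintro ⟨hA, ⟨σ, rfl⟩, hanti⟩
    refine ⟨hA, ?_, hanti⟩
    rw [hA.charpoly_eq]
    exact (Equiv.prod_comp σ fun i => X - C (hA.eigenvalues i : ℂ)).symm
  · rintro ⟨hA, hchar, hanti⟩
    exact ⟨hA, exists_perm_of_prod_X_sub_C_eq (hchar.symm.trans hA.charpoly_eq), hanti⟩

/-- The dimensions of the three factors of the purified bipartite system. -/
def tripartiteDim (m n : ℕ) : Fin 3 → ℕ
  | 0 => m
  | 1 => n
  | 2 => m * n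

variable {m n : ℕ}

/-- The basis index of the tripartite system with the given components. -/
def tripartiteIndex (i : Fin m) (j : Fin n) (k : Fin (m * n)) : ∀ s, Fin (tripartiteDim m n s)
  | 0 => i
  | 1 => j
  | 2 => k

/-- The three spectra, as a family indexed by the factors of the tripartite system. -/
def tripartiteSpectrum (a : Fin m → ℝ) (b : Fin n → ℝ) (c : Fin m × Fin n → ℝ) :
    ∀ s, Fin (tripartiteDim m n s) → ℝ
  | 0 => a
  | 1 => b
  | 2 => c ∘ finProdFinEquiv.symm

/-- The matrix of a tripartite tensor, with respect to the first two factors against the third. -/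
def flattening (ψ : (∀ s, Fin (tripartiteDim m n s)) → ℂ) :
    Matrix (Fin m × Fin n) (Fin m × Fin n) ℂ :=
  Matrix.of fun x y => ψ (tripartiteIndex x.1 x.2 (finProdFinEquiv y))

theorem flattening_surjective (M : Matrix (Fin m × Fin n) (Fin m × Fin n) ℂ) :
    ∃ ψ, flattening ψ = M :=
  ⟨fun x => M (x 0, x 1) (finProdFinEquiv.symm (x 2)), by
    ext x y
    simp [flattening, tripartiteIndex]⟩

theorem sum_tripartite {R : Type*} [AddCommMonoid R]
    (f : (∀ s, Fin (tripartiteDim m n s)) → R) :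
    ∑ x, f x = ∑ i, ∑ j, ∑ y, f (tripartiteIndex i j (finProdFinEquiv y)) := by
  let e : (Fin m × Fin n × (Fin m × Fin n)) ≃ (∀ s, Fin (tripartiteDim m n s)) :=
    { toFun := fun x => tripartiteIndex x.1 x.2.1 (finProdFinEquiv x.2.2)
      invFun := fun x => (x 0, x 1, finProdFinEquiv.symm (x 2))
      left_inv := fun x => by simp [tripartiteIndex]
      right_inv := fun x => by
        ext1 s
        fin_cases s
        · rfl
        · rfl
        · exact finProdFinEquiv.apply_symm_apply (x 2) }
  rw [← e.sum_comp, Fintype.sum_prod_type]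
  refine Finset.sum_congr rfl fun i _ => ?_
  rw [Fintype.sum_prod_type]
  rfl

theorem update_tripartiteIndex_zero (i i' : Fin m) (j : Fin n) (k : Fin (m * n)) :
    Function.update (tripartiteIndex i j k) 0 i' = tripartiteIndex i' j k := by
  ext1 s
  fin_cases s <;> rfl

theorem update_tripartiteIndex_one (i : Fin m) (j j' : Fin n) (k : Fin (m * n)) :
    Function.update (tripartiteIndex i j k) 1 j' = tripartiteIndex i j' k := by
  ext1 s
  fin_cases s <;> rfl

theorem update_tripartiteIndex_two (i : Fin m) (j : Fin n) (k k' : Fin (m * n)) :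
    Function.update (tripartiteIndex i j k) 2 k' = tripartiteIndex i j k' := by
  ext1 s
  fin_cases s <;> rfl

theorem marginal_zero_eq (ψ : (∀ s, Fin (tripartiteDim m n s)) → ℂ) :
    marginal ψ 0 = ptraceB (flattening ψ * (flattening ψ)ᴴ) := by
  ext (i : Fin m) (i' : Fin m)
  change (∑ x, if x 0 = i then ψ x * star (ψ (Function.update x 0 i')) else 0) = _
  rw [sum_tripartite, Finset.sum_eq_single i]
  · simp only [ptraceB, Matrix.of_apply, Matrix.mul_apply, Matrix.conjTranspose_apply, flattening]
    refine Finset.sum_congr rfl fun j _ => Finset.sum_congr rfl fun y _ => ?_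
    refine (if_pos rfl).trans ?_
    rw [update_tripartiteIndex_zero]
  · intro k _ hk
    exact Finset.sum_eq_zero fun j _ => Finset.sum_eq_zero fun y _ => if_neg hk
  · simp

theorem marginal_one_eq (ψ : (∀ s, Fin (tripartiteDim m n s)) → ℂ) :
    marginal ψ 1 = ptraceA (flattening ψ * (flattening ψ)ᴴ) := by
  ext (j : Fin n) (j' : Fin n)
  change (∑ x, if x 1 = j then ψ x * star (ψ (Function.update x 1 j')) else 0) = _
  rw [sum_tripartite]
  simp only [ptraceA, Matrix.of_apply, Matrix.mul_apply, Matrix.conjTranspose_apply, flattening]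
  refine Finset.sum_congr rfl fun i _ => ?_
  rw [Finset.sum_eq_single j]
  · refine Finset.sum_congr rfl fun y _ => ?_
    refine (if_pos rfl).trans ?_
    rw [update_tripartiteIndex_one]
  · intro k _ hk
    exact Finset.sum_eq_zero fun y _ => if_neg hk
  · simp

theorem marginal_two_eq (ψ : (∀ s, Fin (tripartiteDim m n s)) → ℂ) :
    marginal ψ 2 = Matrix.reindex finProdFinEquiv finProdFinEquiv
      ((flattening ψ)ᴴ * flattening ψ)ᵀ := by
  ext (k : Fin (m * n)) (k' : Fin (m * n))
  change (∑ x, if x 2 = k then ψ x * star (ψ (Function.update x 2 k')) else 0) = _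
  rw [sum_tripartite]
  simp only [Matrix.reindex_apply, Matrix.submatrix_apply, Matrix.transpose_apply,
    Matrix.mul_apply, Matrix.conjTranspose_apply]
  rw [Fintype.sum_prod_type]
  refine Finset.sum_congr rfl fun i _ => Finset.sum_congr rfl fun j _ => ?_
  rw [Finset.sum_eq_single (finProdFinEquiv.symm k)]
  · refine (if_pos (finProdFinEquiv.apply_symm_apply k)).trans ?_
    rw [update_tripartiteIndex_two, mul_comm]
    simp only [flattening, Matrix.of_apply, Equiv.apply_symm_apply]
  · intro y _ hy
    exact if_neg fun h => hy ((Equiv.eq_symm_apply _).mpr h)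
  · simp

theorem trace_ptraceB {I J : Type*} [Fintype I] [Fintype J] (ρ : Matrix (I × J) (I × J) ℂ) :
    (ptraceB ρ).trace = ρ.trace := by
  simp [Matrix.trace, ptraceB, Fintype.sum_prod_type]

theorem trace_flattening (ψ : (∀ s, Fin (tripartiteDim m n s)) → ℂ) :
    (flattening ψ * (flattening ψ)ᴴ).trace = sqNorm ψ := by
  rw [← trace_ptraceB, ← marginal_zero_eq, ← trace_marginal ψ 0]
  rfl

open scoped MatrixOrder in
theorem mem_QMP_iff (a : Fin m → ℝ) (b : Fin n → ℝ) (c : Fin m × Fin n → ℝ) :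
    (a, b, c) ∈ QMP m n ↔ ∃ ψ : (∀ s, Fin (tripartiteDim m n s)) → ℂ, sqNorm ψ = 1 ∧
      ∀ s, (marginal ψ s).charpoly = ∏ i, (X - C (tripartiteSpectrum a b c s i : ℂ)) ∧
        Antitone (tripartiteSpectrum a b c s) := by
  have h0 (ψ : (∀ s, Fin (tripartiteDim m n s)) → ℂ) :
      (marginal ψ 0).charpoly = (ptraceB (flattening ψ * (flattening ψ)ᴴ)).charpoly :=
    congrArg Matrix.charpoly (marginal_zero_eq ψ)
  have h1 (ψ : (∀ s, Fin (tripartiteDim m n s)) → ℂ) :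
      (marginal ψ 1).charpoly = (ptraceA (flattening ψ * (flattening ψ)ᴴ)).charpoly :=
    congrArg Matrix.charpoly (marginal_one_eq ψ)
  have h2 (ψ : (∀ s, Fin (tripartiteDim m n s)) → ℂ) :
      (marginal ψ 2).charpoly = (flattening ψ * (flattening ψ)ᴴ).charpoly := by
    refine (congrArg Matrix.charpoly (marginal_two_eq ψ)).trans ?_
    refine (Matrix.charpoly_reindex finProdFinEquiv _).trans ?_
    rw [Matrix.charpoly_transpose, Matrix.charpoly_mul_comm]
  have hc : ∏ i, (X - C (tripartiteSpectrum a b c 2 i : ℂ)) = ∏ y, (X - C (c y : ℂ)) :=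
    finProdFinEquiv.symm.prod_comp fun y => X - C (c y : ℂ)
  constructor
  · rintro ⟨ρ, ⟨hρ, htr⟩, ha, hb, hc'⟩
    rw [isSpectrum_iff] at ha hb hc'
    obtain ⟨M, rfl⟩ : ∃ M, ρ = M * Mᴴ := by
      have := (Matrix.nonneg_iff_posSemidef).mpr hρ
      obtain ⟨B, hB⟩ := CStarAlgebra.nonneg_iff_eq_star_mul_self.mp this
      exact ⟨Bᴴ, by rw [hB, conjTranspose_conjTranspose]; rfl⟩
    obtain ⟨ψ, rfl⟩ := flattening_surjective M
    refine ⟨ψ, ?_, fun s => ?_⟩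
    · rw [trace_flattening] at htr
      exact_mod_cast htr
    · fin_cases s
      · exact ⟨(h0 ψ).trans ha.2.1, ha.2.2⟩
      · exact ⟨(h1 ψ).trans hb.2.1, hb.2.2⟩
      · exact ⟨(h2 ψ).trans (hc'.2.1.trans hc.symm), hc'.2.2⟩
  · rintro ⟨ψ, hψ, h⟩
    refine ⟨flattening ψ * (flattening ψ)ᴴ, ⟨Matrix.posSemidef_self_mul_conjTranspose _, ?_⟩,
      (isSpectrum_iff _ _ _).mpr ⟨?_, (h0 ψ).symm.trans (h 0).1, (h 0).2⟩,
      (isSpectrum_iff _ _ _).mpr ⟨?_, (h1 ψ).symm.trans (h 1).1, (h 1).2⟩,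
      (isSpectrum_iff _ _ _).mpr ⟨Matrix.isHermitian_mul_conjTranspose_self _,
        (h2 ψ).symm.trans ((h 2).1.trans hc), (h 2).2⟩⟩
    · rw [trace_flattening, hψ, Complex.ofReal_one]
    · rw [← marginal_zero_eq]
      exact marginal_isHermitian ψ 0
    · rw [← marginal_one_eq]
      exact marginal_isHermitian ψ 1

end bridge

/-- The set of admissible spectral triples is convex. -/
theorem qmp_convex (m n : ℕ) (hm : 0 < m) (hn : 0 < n)
    (a a' : Fin m → ℝ) (b b' : Fin n → ℝ) (c c' : Fin m × Fin n → ℝ)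
    (h : (a, b, c) ∈ QMP m n) (h' : (a', b', c') ∈ QMP m n)
    (p : ℝ) (hp0 : 0 ≤ p) (hp1 : p ≤ 1) :
    (p • a + (1 - p) • a', p • b + (1 - p) • b', p • c + (1 - p) • c') ∈ QMP m n := by
  obtain ⟨φ, hφ, hs⟩ := (mem_QMP_iff a b c).mp h
  obtain ⟨φ', hφ', hs'⟩ := (mem_QMP_iff a' b' c').mp h'
  obtain ⟨ψ, hψ, hdiag⟩ := exists_marginal_eq_convex_combination φ φ' hφ hφ'
    (fun s => (hs s).2) (fun s => (hs' s).2) (fun s => (hs s).1) (fun s => (hs' s).1) p hp0 hp1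
  have hcomb : ∀ s, tripartiteSpectrum (p • a + (1 - p) • a') (p • b + (1 - p) • b')
      (p • c + (1 - p) • c') s
      = p • tripartiteSpectrum a b c s + (1 - p) • tripartiteSpectrum a' b' c' s := by
    intro s
    fin_cases s <;> rfl
  refine (mem_QMP_iff _ _ _).mpr ⟨ψ, hψ, fun s => ?_⟩
  rw [hdiag, Matrix.charpoly_diagonal, hcomb]
  refine ⟨rfl, fun i j hij => ?_⟩
  exact add_le_add (mul_le_mul_of_nonneg_left ((hs s).2 hij) hp0)
    (mul_le_mul_of_nonneg_left ((hs' s).2 hij) (sub_nonneg.mpr hp1))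
end
end

section
/- Let I and J be nonempty finite types and let v : I × J → ℂ be a unit vector (∑_{(i,j)} |v (i,j)|² = 1). Let ρ : Matrix (I × J) (I × J) ℂ be the rank-one projection ρ (i,j) (i',j') = v (i,j) * conj (v (i',j')), and let ρ^A and ρ^B be its partial traces over the second and first factor respectively. Then the multiset of nonzero eigenvalues of ρ^A (with multiplicity) equals the multiset of nonzero eigenvalues of ρ^B (with multiplicity). -/
open Matrix
open scoped Classical

noncomputable section

namespace Matrix

open Polynomial in
/-- The products `A * B` and `B * A` have the same nonzero eigenvalues, with multiplicity. -/
theorem filter_ne_zero_roots_charpoly_mul_comm {m n K : Type*} [Fintype m] [Fintype n]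
    [DecidableEq m] [DecidableEq n] [Field K] (A : Matrix m n K) (B : Matrix n m K) :
    (A * B).charpoly.roots.filter (fun x => x ≠ 0) =
      (B * A).charpoly.roots.filter (fun x => x ≠ 0) := by
  have key (k : ℕ) {p : K[X]} (hp : p.Monic) :
      (X ^ k * p).roots.filter (fun x => x ≠ 0) = p.roots.filter (fun x => x ≠ 0) := by
    rw [roots_mul ((monic_X_pow k).mul hp).ne_zero, roots_X_pow, Multiset.filter_add,
      Multiset.filter_eq_nil.2, zero_add]
    intro a ha
    simpa using Multiset.mem_singleton.1 (Multiset.mem_of_mem_nsmul ha)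
  rw [← key (Fintype.card n) (charpoly_monic _), charpoly_mul_comm', key _ (charpoly_monic _)]

theorem IsHermitian.map_filter_ne_zero_eigenvalues {n : Type*} [Fintype n] [DecidableEq n]
    {A : Matrix n n ℂ} (hA : A.IsHermitian) :
    ((Finset.univ.val.map hA.eigenvalues).filter (fun x => x ≠ 0)).map Complex.ofReal =
      A.charpoly.roots.filter (fun x => x ≠ 0) := by
  rw [hA.roots_charpoly_eq_eigenvalues, ← Multiset.map_map, Multiset.filter_map,
    Multiset.filter_map, Multiset.filter_map, Multiset.map_map, Multiset.map_map]
  simp [Function.comp_def]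

end Matrix

theorem ptraceB_pure {I J : Type*} [Fintype J] (v : I × J → ℂ) :
    ptraceB (Matrix.of fun p q => v p * (starRingEnd ℂ) (v q)) =
      Matrix.of v.curry * (Matrix.of v.curry)ᴴ := by
  ext i i'
  simp [ptraceB, Matrix.mul_apply]

theorem ptraceA_pure {I J : Type*} [Fintype I] (v : I × J → ℂ) :
    ptraceA (Matrix.of fun p q => v p * (starRingEnd ℂ) (v q)) =
      ((Matrix.of v.curry)ᴴ * Matrix.of v.curry)ᵀ := by
  ext j j'
  simp [ptraceA, Matrix.mul_apply, mul_comm]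

/-- For a pure state, the nonzero eigenvalues (with multiplicity) of the two reduced
density matrices coincide. -/
theorem pure_state_marginals_same_nonzero_eigenvalues
    {I J : Type*} [Fintype I] [Fintype J] [DecidableEq I] [DecidableEq J]
    [Nonempty I] [Nonempty J]
    (v : I × J → ℂ) (hv : ∑ p, ‖v p‖ ^ 2 = 1)
    (ρ : Matrix (I × J) (I × J) ℂ)
    (hρ : ρ = Matrix.of fun p q => v p * (starRingEnd ℂ) (v q))
    (hA : (ptraceB ρ).IsHermitian) (hB : (ptraceA ρ).IsHermitian) :
    Multiset.filter (fun x : ℝ => x ≠ 0) (Finset.univ.val.map hA.eigenvalues) =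
    Multiset.filter (fun x : ℝ => x ≠ 0) (Finset.univ.val.map hB.eigenvalues) := by
  apply Multiset.map_injective Complex.ofReal_injective
  rw [hA.map_filter_ne_zero_eigenvalues, hB.map_filter_ne_zero_eigenvalues, hρ, ptraceB_pure,
    ptraceA_pure, Matrix.charpoly_transpose, Matrix.filter_ne_zero_roots_charpoly_mul_comm]
end
end

section
/- Every density operator admits a purification: if I is a nonempty finite type and ρ : Matrix I I ℂ is positive semidefinite with trace 1, then there exists a unit vector v : I × I → ℂ (∑_{(i,k)} |v (i,k)|² = 1) such that the partial trace over the second factor of the rank-one projection |v⟩⟨v| equals ρ; that is, for all i, i' : I, ∑_k v (i,k) * conj (v (i',k)) = ρ i i'. -/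
open Matrix
open scoped ComplexOrder

noncomputable section

/-- Every density operator admits a purification. -/
theorem density_operator_purification {I : Type*} [Fintype I] [DecidableEq I] [Nonempty I]
    (ρ : Matrix I I ℂ) (hρ : ρ.PosSemidef) (htr : ρ.trace = 1) :
    ∃ v : I × I → ℂ, (∑ p, ‖v p‖ ^ 2 = 1) ∧
      ∀ i i' : I, ∑ k, v (i, k) * (starRingEnd ℂ) (v (i', k)) = ρ i i' := by
  open scoped MatrixOrder in
  obtain ⟨B, hB⟩ := CStarAlgebra.nonneg_iff_eq_mul_star_self.mp hρ.nonneg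
  have key : ∀ i i' : I, ∑ k, B i k * (starRingEnd ℂ) (B i' k) = ρ i i' := by
    intro i i'
    rw [hB, Matrix.mul_apply]
    rfl
  refine ⟨fun p => B p.1 p.2, ?_, key⟩
  have h : ((∑ p : I × I, ‖B p.1 p.2‖ ^ 2 : ℝ) : ℂ) = 1 := by
    rw [← htr, Matrix.trace, Fintype.sum_prod_type]
    push_cast
    refine Finset.sum_congr rfl fun i _ => ?_
    rw [Matrix.diag_apply, ← key i i]
    exact Finset.sum_congr rfl fun k _ => (Complex.mul_conj' _).symm
  exact_mod_cast h
end
end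

section
/- Quantum union bound for three subsystems: let I, J, K be finite types, let ρ : Matrix (I × J × K) (I × J × K) ℂ be positive semidefinite with trace 1, and let ρ^I, ρ^J, ρ^K be its partial traces onto the first, second and third factor. Let P : Matrix I I ℂ, Q : Matrix J J ℂ, R : Matrix K K ℂ be orthogonal projections (Hermitian with P*P = P, and similarly for Q, R). If the real parts of Tr(P * ρ^I), Tr(Q * ρ^J) and Tr(R * ρ^K) are each at least 1 - ε, then the real part of Tr((P ⊗ Q ⊗ R) * ρ) is at least 1 - 3ε, where P ⊗ Q ⊗ R is the matrix with ((i,j,k),(i',j',k')) entry P i i' * Q j j' * R k k'. -/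
open Matrix
open scoped ComplexOrder

noncomputable section

/-- Partial trace onto the first factor of a tripartite system. -/
def ptrace1 {I J K : Type*} [Fintype J] [Fintype K]
    (ρ : Matrix (I × J × K) (I × J × K) ℂ) : Matrix I I ℂ :=
  Matrix.of fun i i' => ∑ j, ∑ k, ρ (i, j, k) (i', j, k)

/-- Partial trace onto the second factor of a tripartite system. -/
def ptrace2 {I J K : Type*} [Fintype I] [Fintype K]
    (ρ : Matrix (I × J × K) (I × J × K) ℂ) : Matrix J J ℂ :=
  Matrix.of fun j j' => ∑ i, ∑ k, ρ (i, j, k) (i, j', k)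

/-- Partial trace onto the third factor of a tripartite system. -/
def ptrace3 {I J K : Type*} [Fintype I] [Fintype J]
    (ρ : Matrix (I × J × K) (I × J × K) ℂ) : Matrix K K ℂ :=
  Matrix.of fun k k' => ∑ i, ∑ j, ρ (i, j, k) (i, j, k')

/-- Kronecker (tensor) product of three matrices. -/
def kron3 {I J K : Type*} (P : Matrix I I ℂ) (Q : Matrix J J ℂ) (R : Matrix K K ℂ) :
    Matrix (I × J × K) (I × J × K) ℂ :=
  Matrix.of fun p q => P p.1 q.1 * Q p.2.1 q.2.1 * R p.2.2 q.2.2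

open Kronecker in
theorem kron3_eq_kronecker {I J K : Type*} (P : Matrix I I ℂ) (Q : Matrix J J ℂ)
    (R : Matrix K K ℂ) : kron3 P Q R = P ⊗ₖ (Q ⊗ₖ R) := by
  ext p q
  simp [kron3, mul_assoc]

theorem isStarProjection_kron3 {I J K : Type*} [Fintype I] [Fintype J] [Fintype K]
    {P : Matrix I I ℂ} {Q : Matrix J J ℂ} {R : Matrix K K ℂ}
    (hP : IsStarProjection P) (hQ : IsStarProjection Q) (hR : IsStarProjection R) :
    IsStarProjection (kron3 P Q R) where
  isIdempotentElem := by
    rw [IsIdempotentElem, kron3_eq_kronecker, ← mul_kronecker_mul, ← mul_kronecker_mul,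
      hP.isIdempotentElem.eq, hQ.isIdempotentElem.eq, hR.isIdempotentElem.eq]
  isSelfAdjoint := by
    rw [IsSelfAdjoint, kron3_eq_kronecker, star_eq_conjTranspose, conjTranspose_kronecker,
      conjTranspose_kronecker, ← star_eq_conjTranspose, ← star_eq_conjTranspose,
      ← star_eq_conjTranspose, hP.isSelfAdjoint.star_eq, hQ.isSelfAdjoint.star_eq,
      hR.isSelfAdjoint.star_eq]

/-- A projection has nonnegative expectation in a positive semidefinite matrix. -/
theorem re_trace_mul_nonneg_of_isStarProjection {n : Type*} [Fintype n]
    {M ρ : Matrix n n ℂ} (hM : IsStarProjection M) (hρ : ρ.PosSemidef) :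
    0 ≤ (M * ρ).trace.re := by
  have h := (hρ.mul_mul_conjTranspose_same M).trace_nonneg
  rw [← star_eq_conjTranspose, hM.isSelfAdjoint.star_eq, trace_mul_comm, ← mul_assoc,
    hM.isIdempotentElem.eq] at h
  exact (Complex.le_def.mp h).1

section PartialTrace

variable {I J K : Type*} [Fintype I] [Fintype J] [Fintype K]
  (ρ : Matrix (I × J × K) (I × J × K) ℂ)

theorem trace_mul_ptrace1 [DecidableEq J] [DecidableEq K] (P : Matrix I I ℂ) :
    (P * ptrace1 ρ).trace = (kron3 P 1 1 * ρ).trace := by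
  simp only [trace, diag_apply, mul_apply, ptrace1, kron3, of_apply, Fintype.sum_prod_type,
    one_apply, Finset.mul_sum, mul_ite, ite_mul, mul_one, mul_zero, zero_mul,
    Finset.sum_ite_eq, Finset.mem_univ, if_true]
  refine Finset.sum_congr rfl fun i _ => ?_
  rw [Finset.sum_comm]
  exact Finset.sum_congr rfl fun j _ => Finset.sum_comm

theorem trace_mul_ptrace2 [DecidableEq I] [DecidableEq K] (Q : Matrix J J ℂ) :
    (Q * ptrace2 ρ).trace = (kron3 1 Q 1 * ρ).trace := by
  simp only [trace, diag_apply, mul_apply, ptrace2, kron3, of_apply, Fintype.sum_prod_type,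
    one_apply, Finset.mul_sum, mul_ite, ite_mul, mul_one, one_mul, mul_zero, zero_mul,
    Finset.sum_ite_eq, Finset.sum_ite_irrel, Finset.sum_const_zero, Finset.mem_univ, if_true]
  rw [Finset.sum_congr rfl fun _ _ => Finset.sum_comm, Finset.sum_comm]
  exact Finset.sum_congr rfl fun i _ => Finset.sum_congr rfl fun j _ => Finset.sum_comm

theorem trace_mul_ptrace3 [DecidableEq I] [DecidableEq J] (R : Matrix K K ℂ) :
    (R * ptrace3 ρ).trace = (kron3 1 1 R * ρ).trace := by
  simp only [trace, diag_apply, mul_apply, ptrace3, kron3, of_apply, Fintype.sum_prod_type,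
    one_apply, Finset.mul_sum, mul_ite, ite_mul, mul_one, one_mul, mul_zero, zero_mul,
    Finset.sum_ite_eq, Finset.sum_ite_irrel, Finset.sum_const_zero, Finset.mem_univ, if_true]
  rw [Finset.sum_congr rfl fun _ _ => Finset.sum_comm, Finset.sum_comm]
  refine Finset.sum_congr rfl fun i _ => ?_
  rw [Finset.sum_congr rfl fun _ _ => Finset.sum_comm, Finset.sum_comm]

end PartialTrace

theorem kron3_add_one_add_one {I J K : Type*} [DecidableEq I] [DecidableEq J] [DecidableEq K]
    (P : Matrix I I ℂ) (Q : Matrix J J ℂ) (R : Matrix K K ℂ) :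
    kron3 P Q R + 1 + 1 = kron3 P 1 1 + kron3 1 Q 1 + kron3 1 1 R +
      (kron3 (1 - P) (1 - Q) 1 + kron3 (1 - P) Q (1 - R) + kron3 1 (1 - Q) (1 - R)) := by
  have h : (1 : Matrix (I × J × K) (I × J × K) ℂ) = kron3 1 1 1 := by
    rw [kron3_eq_kronecker, one_kronecker_one, one_kronecker_one]
  rw [h]
  ext p q
  simp only [kron3, Matrix.add_apply, Matrix.sub_apply, of_apply]
  ring

/-- Quantum union bound for three subsystems. -/
theorem quantum_union_bound {I J K : Type*} [Fintype I] [Fintype J] [Fintype K]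
    [DecidableEq I] [DecidableEq J] [DecidableEq K]
    (ρ : Matrix (I × J × K) (I × J × K) ℂ) (hρ : ρ.PosSemidef) (htr : ρ.trace = 1)
    (P : Matrix I I ℂ) (Q : Matrix J J ℂ) (R : Matrix K K ℂ)
    (hP : P.IsHermitian) (hP2 : P * P = P)
    (hQ : Q.IsHermitian) (hQ2 : Q * Q = Q)
    (hR : R.IsHermitian) (hR2 : R * R = R)
    (ε : ℝ)
    (hPtr : 1 - ε ≤ ((P * ptrace1 ρ).trace).re)
    (hQtr : 1 - ε ≤ ((Q * ptrace2 ρ).trace).re)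
    (hRtr : 1 - ε ≤ ((R * ptrace3 ρ).trace).re) :
    1 - 3 * ε ≤ ((kron3 P Q R * ρ).trace).re := by
  have hP' : IsStarProjection P := ⟨hP2, hP⟩
  have hQ' : IsStarProjection Q := ⟨hQ2, hQ⟩
  have hR' : IsStarProjection R := ⟨hR2, hR⟩
  have h₁ := re_trace_mul_nonneg_of_isStarProjection
    (isStarProjection_kron3 hP'.one_sub hQ'.one_sub (.one (R := Matrix K K ℂ))) hρ
  have h₂ := re_trace_mul_nonneg_of_isStarProjection
    (isStarProjection_kron3 hP'.one_sub hQ' hR'.one_sub) hρ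
  have h₃ := re_trace_mul_nonneg_of_isStarProjection
    (isStarProjection_kron3 (.one (R := Matrix I I ℂ)) hQ'.one_sub hR'.one_sub) hρ
  have h := congrArg (fun M => (M * ρ).trace.re) (kron3_add_one_add_one P Q R)
  simp only [add_mul, one_mul, trace_add, Complex.add_re, htr, Complex.one_re] at h
  rw [trace_mul_ptrace1] at hPtr
  rw [trace_mul_ptrace2] at hQtr
  rw [trace_mul_ptrace3] at hRtr
  linarith
end
end

section
/- Let k and d be positive integers. The subspace of symmetric tensors in (ℂ^d)^{⊗k}, realized concretely as the ℂ-subspace of functions ψ : (Fin k → Fin d) → ℂ satisfying ψ (x ∘ σ) = ψ x for every permutation σ of Fin k and every x : Fin k → Fin d, has dimension (k + d - 1).choose (d - 1). -/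
noncomputable section

/-- The symmetric subspace of `(ℂ^d)^{⊗ k}`, realized as the subspace of functions
`(Fin k → Fin d) → ℂ` invariant under permutation of the `k` tensor factors. -/
def symSubspace (k d : ℕ) : Submodule ℂ ((Fin k → Fin d) → ℂ) where
  carrier := {ψ | ∀ σ : Equiv.Perm (Fin k), ∀ x : Fin k → Fin d, ψ (x ∘ σ) = ψ x}
  add_mem' := by
    intro f g hf hg σ x
    simp [hf σ x, hg σ x]
  zero_mem' := by
    intro σ x
    rfl
  smul_mem' := by
    intro c f hf σ x
    simp [hf σ x]

/-- The unordered tuple of values of a function on `Fin k`. -/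
def Sym.ofFn {α : Type*} {k : ℕ} (x : Fin k → α) : Sym α k :=
  ⟨(Finset.univ : Finset (Fin k)).val.map x, by simp⟩

theorem Sym.ofFn_comp_perm {α : Type*} {k : ℕ} (x : Fin k → α) (σ : Equiv.Perm (Fin k)) :
    Sym.ofFn (x ∘ σ) = Sym.ofFn x := by
  apply Subtype.ext
  simp only [Sym.ofFn]
  rw [← Multiset.map_map, Multiset.map_univ_val_equiv]

theorem Sym.exists_perm_of_ofFn_eq {α : Type*} {k : ℕ} {x y : Fin k → α}
    (h : Sym.ofFn x = Sym.ofFn y) : ∃ σ : Equiv.Perm (Fin k), y ∘ σ = x := by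
  classical
  have hcard (c : α) : Fintype.card {i // x i = c} = Fintype.card {i // y i = c} := by
    have hc := congrArg (fun s : Sym α k => Multiset.count c s.1) h
    simp only [Sym.ofFn, Multiset.count_map] at hc
    simpa only [Fintype.card_subtype, Finset.card_def, Finset.filter_val, eq_comm] using hc
  exact ⟨Equiv.ofFiberEquiv fun c => Fintype.equivOfCardEq (hcard c),
    funext fun i => Equiv.ofFiberEquiv_map _ i⟩

theorem Sym.ofFn_surjective {α : Type*} {k : ℕ} :
    Function.Surjective (Sym.ofFn : (Fin k → α) → Sym α k) := by
  rintro ⟨⟨l⟩, rfl⟩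
  exact ⟨l.get, Subtype.ext ((Fin.univ_val_map l.get).trans (congrArg _ (List.ofFn_get l)))⟩

theorem symSubspace_eq_range_funLeft (k d : ℕ) :
    symSubspace k d =
      LinearMap.range (LinearMap.funLeft ℂ ℂ (Sym.ofFn : (Fin k → Fin d) → Sym (Fin d) k)) := by
  ext ψ
  constructor
  · intro hψ
    refine ⟨fun s => ψ (Function.surjInv Sym.ofFn_surjective s), funext fun x => ?_⟩
    obtain ⟨σ, hσ⟩ := Sym.exists_perm_of_ofFn_eq
      (Function.surjInv_eq Sym.ofFn_surjective (Sym.ofFn x))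
    change ψ _ = ψ x
    rw [← hσ]
    exact hψ σ x
  · rintro ⟨φ, rfl⟩ σ x
    simp only [LinearMap.funLeft_apply, Sym.ofFn_comp_perm]

/-- The dimension of the symmetric subspace of `(ℂ^d)^{⊗ k}` is `(k + d - 1).choose (d - 1)`. -/
theorem finrank_symSubspace (k d : ℕ) (hk : 0 < k) (hd : 0 < d) :
    Module.finrank ℂ (symSubspace k d) = (k + d - 1).choose (d - 1) := by
  rw [symSubspace_eq_range_funLeft, LinearMap.finrank_range_of_inj
    (LinearMap.funLeft_injective_of_surjective ℂ ℂ _ Sym.ofFn_surjective),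
    Module.finrank_fintype_fun_eq_card, Sym.card_sym_eq_choose, Fintype.card_fin, add_comm d k]
  exact Nat.choose_symm_of_eq_add (by lia)
end
end
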